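/- arXiv:1412.8670 — 4 statements merged into one kernel-verified Lean document; each statement's English description precedes it below -/
import Mathlib

section
/- Any admissible rate pair (R1,R2) for the zero-error binary adder channel satisfies R2 ≤ min over α ∈ [0, h⁻¹(R1)] of (1−α)·( R_Σ(α/(1−α), Γ) − Γ ), where Γ = h( (h⁻¹(R1)−α)/(1−α) ). -/
/-- The binary entropy function (base 2). -/
noncomputable def binH (p : ℝ) : ℝ :=
  -(p * Real.logb 2 p) - (1 - p) * Real.logb 2 (1 - p)

/-- The inverse of the binary entropy function, restricted to `[0, 1/2]`. -/
noncomputable def binHInv (y : ℝ) : ℝ :=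
  sInf {p : ℝ | 0 ≤ p ∧ p ≤ 1 / 2 ∧ binH p = y}

/-- `p ⋆ q = p(1-q) + q(1-p)`. -/
def star (p q : ℝ) : ℝ := p * (1 - q) + q * (1 - p)

/-- `L(η) = h(η) + 1 - η`. -/
noncomputable def Lfun (η : ℝ) : ℝ := binH η + 1 - η

/-- The function `J(p, η)`. -/
noncomputable def Jfun (p η : ℝ) : ℝ :=
  if star p p ≤ η then
    2 * binH (1 / 2 * (1 - Real.sqrt (1 - 2 * η))) - η
  else
    2 * binH (1 / 2 * (1 - (1 - η - star p p) / Real.sqrt (1 - 2 * star p p)))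
      - 1 / 2 * (1 - (1 - η - star p p) ^ 2 / (1 - 2 * star p p))

/-- `R_Σ(r0, r1) = max_{η ∈ [h⁻¹(r1), 1/2]} min {L(η), J(h⁻¹(r1), η) + r0}`. -/
noncomputable def RSigma (r0 r1 : ℝ) : ℝ :=
  sSup ((fun η => min (Lfun η) (Jfun (binHInv r1) η + r0)) '' Set.Icc (binHInv r1) (1 / 2))

/-- `C1, C2 ⊆ {0,1}^n` form a zero-error codebook pair: the sum map is injective on `C1 × C2`. -/
def ZeroErrorPair {n : ℕ} (C1 C2 : Finset (Fin n → Fin 2)) : Prop :=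
  Set.InjOn
    (fun p : (Fin n → Fin 2) × (Fin n → Fin 2) => fun i : Fin n => (p.1 i : ℕ) + (p.2 i : ℕ))
    (↑(C1 ×ˢ C2))

/-- `(R1, R2)` is admissible for the zero-error binary adder channel. -/
def Admissible (R1 R2 : ℝ) : Prop :=
  0 ≤ R1 ∧ 0 ≤ R2 ∧
    ∀ ε : ℝ, 0 < ε → ∀ N : ℕ, ∃ n : ℕ, N ≤ n ∧
      ∃ C1 C2 : Finset (Fin n → Fin 2), ZeroErrorPair C1 C2 ∧
        (2 : ℝ) ^ ((n : ℝ) * (R1 - ε)) ≤ C1.card ∧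
        (2 : ℝ) ^ ((n : ℝ) * (R2 - ε)) ≤ C2.card



lemma binH_eq (p : ℝ) : binH p = Real.binEntropy p / Real.log 2 := by
  unfold binH Real.binEntropy Real.logb
  rw [Real.log_inv, Real.log_inv]
  ring

lemma binH_one_sub (p : ℝ) : binH (1 - p) = binH p := by
  rw [binH_eq, binH_eq, Real.binEntropy_one_sub]

lemma binH_continuous : Continuous binH := by
  have : binH = fun p => Real.binEntropy p / Real.log 2 := funext binH_eq
  rw [this]
  fun_prop

lemma log_two_pos' : 0 < Real.log 2 := Real.log_pos (by norm_num)

lemma binH_zero : binH 0 = 0 := by simp [binH_eq]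

lemma binH_half : binH (1 / 2) = 1 := by
  rw [binH_eq, one_div, Real.binEntropy_two_inv, div_self log_two_pos'.ne']

lemma binH_le_one (p : ℝ) : binH p ≤ 1 := by
  rw [binH_eq, div_le_one log_two_pos']
  exact Real.binEntropy_le_log_two

lemma binH_nonneg {p : ℝ} (h0 : 0 ≤ p) (h1 : p ≤ 1) : 0 ≤ binH p := by
  rw [binH_eq]
  exact div_nonneg (Real.binEntropy_nonneg h0 h1) log_two_pos'.le

lemma binH_strictMonoOn : StrictMonoOn binH (Set.Icc 0 (1 / 2)) := by
  intro a ha b hb hab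
  rw [binH_eq, binH_eq]
  rw [one_div] at ha hb
  exact div_lt_div_of_pos_right (Real.binEntropy_strictMonoOn ha hb hab) log_two_pos'

lemma binHInv_binH {x : ℝ} (h0 : 0 ≤ x) (h1 : x ≤ 1 / 2) : binHInv (binH x) = x := by
  have : {p : ℝ | 0 ≤ p ∧ p ≤ 1 / 2 ∧ binH p = binH x} = {x} := by
    ext p
    simp only [Set.mem_ofPred_eq, Set.mem_singleton_iff]
    constructor
    · rintro ⟨a, b, c⟩
      exact binH_strictMonoOn.injOn ⟨a, b⟩ ⟨h0, h1⟩ c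
    · rintro rfl
      exact ⟨h0, h1, rfl⟩
  rw [binHInv, this, csInf_singleton]

lemma binHInv_spec {y : ℝ} (h0 : 0 ≤ y) (h1 : y ≤ 1) :
    0 ≤ binHInv y ∧ binHInv y ≤ 1 / 2 ∧ binH (binHInv y) = y := by
  have := intermediate_value_Icc (show (0 : ℝ) ≤ 1 / 2 by norm_num) binH_continuous.continuousOn
  rw [binH_zero, binH_half] at this
  obtain ⟨x, ⟨hx0, hx1⟩, rfl⟩ := this ⟨h0, h1⟩
  rw [binHInv_binH hx0 hx1]
  exact ⟨hx0, hx1, rfl⟩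

/-- The entropy as a function of the squared bias. -/
noncomputable def phiF (w : ℝ) : ℝ := binH ((1 - Real.sqrt w) / 2)

/-- Entropy of the sum of two iid bits as a function of the squared bias. -/
noncomputable def KF (w : ℝ) : ℝ := 2 * phiF w - (1 - w) / 2

lemma phiF_continuous : Continuous phiF := by
  unfold phiF
  exact binH_continuous.comp (by fun_prop)

lemma KF_continuous : Continuous KF := by
  unfold KF
  have := phiF_continuous
  fun_prop

lemma phiF_sq (x : ℝ) : phiF ((1 - 2 * x) ^ 2) = binH x := by
  unfold phiF
  rw [Real.sqrt_sq_eq_abs]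
  rcases abs_cases (1 - 2 * x) with ⟨h, _⟩ | ⟨h, _⟩ <;> rw [h]
  · congr 1; ring
  · rw [← binH_one_sub x]; congr 1; ring

/-- `log((1+s)/(1-s))/s` -/
noncomputable def gF (s : ℝ) : ℝ := (Real.log (1 + s) - Real.log (1 - s)) / s

lemma gF_hasSum {s : ℝ} (h0 : 0 < s) (h1 : s < 1) :
    HasSum (fun k : ℕ => 2 * (1 / (2 * (k : ℝ) + 1)) * s ^ (2 * k)) (gF s) := by
  have := (Real.hasSum_log_sub_log_of_abs_lt_one (x := s) (by rw [abs_of_pos h0]; exact h1)).div_const s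
  have e : (fun k : ℕ => 2 * (1 / (2 * (k : ℝ) + 1)) * s ^ (2 * k)) =
      fun k : ℕ => 2 * (1 / (2 * (k : ℝ) + 1)) * s ^ (2 * k + 1) / s := by
    funext k
    rw [pow_succ, ← mul_assoc, mul_div_assoc, div_self h0.ne', mul_one]
  rw [e]
  exact this

lemma gF_mono {s t : ℝ} (h0 : 0 < s) (hst : s ≤ t) (h1 : t < 1) : gF s ≤ gF t := by
  refine hasSum_le (fun k => ?_) (gF_hasSum h0 (hst.trans_lt h1)) (gF_hasSum (h0.trans_le hst) h1)
  gcongr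

lemma gF_ge {s : ℝ} (h0 : 0 < s) (h1 : s < 1) : 2 ≤ gF s := by
  have := le_hasSum (gF_hasSum h0 h1) 0 (fun k _ => by positivity)
  simpa using this

lemma phiF_hasDerivAt {w : ℝ} (h0 : 0 < w) (h1 : w < 1) :
    HasDerivAt phiF (-(gF (Real.sqrt w)) / (4 * Real.log 2)) w := by
  have hs0 : 0 < Real.sqrt w := Real.sqrt_pos.2 h0
  have hs1 : Real.sqrt w < 1 := by
    rw [Real.sqrt_lt' one_pos]; simpa using h1
  have hd := Real.hasDerivAt_binEntropy (p := (1 - Real.sqrt w) / 2) (by linarith) (by linarith)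
  have hi : HasDerivAt (fun w : ℝ => (1 - Real.sqrt w) / 2) (-(1 / (2 * Real.sqrt w)) / 2) w := by
    have := ((Real.hasDerivAt_sqrt h0.ne').const_sub 1).div_const 2
    exact this
  have := (hd.comp w hi).div_const (Real.log 2)
  have hf : phiF = fun w => (Real.binEntropy ∘ fun w => (1 - Real.sqrt w) / 2) w / Real.log 2 := by
    funext w; simp [phiF, binH_eq]
  rw [hf]
  refine this.congr_deriv ?_
  have e1 : 1 - (1 - Real.sqrt w) / 2 = (1 + Real.sqrt w) / 2 := by ring
  rw [e1, Real.log_div (by linarith) (by norm_num), Real.log_div (by linarith) (by norm_num), gF]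
  have := log_two_pos'
  field_simp
  ring

lemma phiF_concave : ConcaveOn ℝ (Set.Icc 0 1) phiF := by
  apply AntitoneOn.concaveOn_of_deriv (convex_Icc 0 1) phiF_continuous.continuousOn
  · rw [interior_Icc]
    intro w hw
    exact (phiF_hasDerivAt hw.1 hw.2).differentiableAt.differentiableWithinAt
  · rw [interior_Icc]
    intro a ha b hb hab
    rw [(phiF_hasDerivAt ha.1 ha.2).deriv, (phiF_hasDerivAt hb.1 hb.2).deriv]
    have := gF_mono (Real.sqrt_pos.2 ha.1) (Real.sqrt_le_sqrt hab)
      (by rw [Real.sqrt_lt' one_pos]; simpa using hb.2)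
    have := log_two_pos'
    gcongr

lemma KF_concave : ConcaveOn ℝ (Set.Icc 0 1) KF := by
  refine ⟨convex_Icc 0 1, fun x hx y hy a b ha hb hab => ?_⟩
  have := phiF_concave.2 hx hy ha hb hab
  simp only [smul_eq_mul, KF] at this ⊢
  obtain rfl : b = 1 - a := by linarith
  linarith

lemma KF_antitone : AntitoneOn KF (Set.Icc 0 1) := by
  have hd : ∀ w ∈ Set.Ioo (0 : ℝ) 1,
      HasDerivAt KF (2 * (-(gF (Real.sqrt w)) / (4 * Real.log 2)) - (-1) / 2) w := by
    intro w hw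
    have h1 := (phiF_hasDerivAt hw.1 hw.2).const_mul 2
    have h2 := ((hasDerivAt_id w).const_sub 1).div_const 2
    exact h1.sub h2
  apply antitoneOn_of_deriv_nonpos (convex_Icc 0 1) KF_continuous.continuousOn
  · rw [interior_Icc]
    intro w hw
    exact (hd w hw).differentiableAt.differentiableWithinAt
  · rw [interior_Icc]
    intro w hw
    rw [(hd w hw).deriv]
    have h2 : 2 ≤ gF (Real.sqrt w) := gF_ge (Real.sqrt_pos.2 hw.1)
      (by rw [Real.sqrt_lt' one_pos]; simpa using hw.2)
    have h3 := log_two_pos'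
    have h4 : Real.log 2 ≤ 1 := by have := Real.log_two_lt_d9; linarith
    have : 1 / 4 ≤ gF (Real.sqrt w) / (4 * Real.log 2) := by
      rw [le_div_iff₀ (by positivity)]; linarith
    rw [neg_div]; linarith

lemma KF_le (w : ℝ) (h1 : w ≤ 1) (h0 : 0 ≤ w) : KF w ≤ 3 / 2 := by
  have h := KF_antitone (a := 0) (b := w) (by simp) ⟨h0, h1⟩ h0
  have : KF 0 = 3 / 2 := by
    unfold KF phiF
    rw [Real.sqrt_zero, sub_zero, binH_half]; norm_num
  linarith

/-- The lower bound for the mean squared bias. -/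
noncomputable def TF (c β : ℝ) : ℝ := β + (max (β - c ^ 2) 0 / (2 * c)) ^ 2

/-- Single-letter averaging lemma. -/
lemma avg_lemma {I : Type*} (s : Finset I) (l x y : I → ℝ) (hl : ∀ i ∈ s, 0 ≤ l i)
    (hl1 : ∑ i ∈ s, l i = 1) (hx : ∀ i ∈ s, x i ∈ Set.Icc (0 : ℝ) 1)
    (hy : ∀ i ∈ s, y i ∈ Set.Icc (0 : ℝ) 1) (p η : ℝ) (hp0 : 0 ≤ p) (hp1 : p ≤ 1 / 2)
    (hp : binH p ≤ ∑ i ∈ s, l i * binH (x i))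
    (hη : η = ∑ i ∈ s, l i * (x i + y i - 2 * x i * y i)) :
    p ≤ η ∧
    (∑ i ∈ s, l i * (2 * binH ((x i + y i) / 2) - (x i + y i - 2 * x i * y i)) ≤ 3 / 2) ∧
    (η ≤ 1 / 2 →
      ∑ i ∈ s, l i * (2 * binH ((x i + y i) / 2) - (x i + y i - 2 * x i * y i))
        ≤ KF (TF (1 - 2 * p) (1 - 2 * η))) := by
  set a := ∑ i ∈ s, l i * (1 - 2 * x i) ^ 2 with ha
  set b := ∑ i ∈ s, l i * (1 - 2 * y i) ^ 2 with hb
  set β := ∑ i ∈ s, l i * ((1 - 2 * x i) * (1 - 2 * y i)) with hβ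
  have hβη : 1 - 2 * η = β := by
    have : β = ∑ i ∈ s, l i - 2 * ∑ i ∈ s, l i * (x i + y i - 2 * x i * y i) := by
      rw [hβ, Finset.mul_sum, ← Finset.sum_sub_distrib]
      exact Finset.sum_congr rfl fun i _ => by ring
    rw [this, hl1, hη]
  have hsqx : ∀ i ∈ s, (1 - 2 * x i) ^ 2 ∈ Set.Icc (0 : ℝ) 1 := fun i hi =>
    ⟨sq_nonneg _, by have := hx i hi; nlinarith [this.1, this.2]⟩
  have hsqy : ∀ i ∈ s, (1 - 2 * y i) ^ 2 ∈ Set.Icc (0 : ℝ) 1 := fun i hi =>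
    ⟨sq_nonneg _, by have := hy i hi; nlinarith [this.1, this.2]⟩
  have ha0 : 0 ≤ a := Finset.sum_nonneg fun i hi => mul_nonneg (hl i hi) (sq_nonneg _)
  have hb0 : 0 ≤ b := Finset.sum_nonneg fun i hi => mul_nonneg (hl i hi) (sq_nonneg _)
  have ha1 : a ≤ 1 := by
    rw [← hl1]
    exact Finset.sum_le_sum fun i hi => by nlinarith [hl i hi, (hsqx i hi).2]
  have hb1 : b ≤ 1 := by
    rw [← hl1]
    exact Finset.sum_le_sum fun i hi => by nlinarith [hl i hi, (hsqy i hi).2]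
  have hcs : β ^ 2 ≤ a * b := by
    have := Finset.sum_mul_sq_le_sq_mul_sq s (fun i => Real.sqrt (l i) * (1 - 2 * x i))
      (fun i => Real.sqrt (l i) * (1 - 2 * y i))
    have e1 : ∑ i ∈ s, Real.sqrt (l i) * (1 - 2 * x i) * (Real.sqrt (l i) * (1 - 2 * y i)) = β := by
      refine Finset.sum_congr rfl fun i hi => ?_
      have := Real.mul_self_sqrt (hl i hi)
      linear_combination ((1 - 2 * x i) * (1 - 2 * y i)) * this
    have e2 : ∑ i ∈ s, (Real.sqrt (l i) * (1 - 2 * x i)) ^ 2 = a := by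
      refine Finset.sum_congr rfl fun i hi => ?_
      have := Real.mul_self_sqrt (hl i hi)
      linear_combination ((1 - 2 * x i) ^ 2) * this
    have e3 : ∑ i ∈ s, (Real.sqrt (l i) * (1 - 2 * y i)) ^ 2 = b := by
      refine Finset.sum_congr rfl fun i hi => ?_
      have := Real.mul_self_sqrt (hl i hi)
      linear_combination ((1 - 2 * y i) ^ 2) * this
    rw [e1, e2, e3] at this
    exact this
  set c := 1 - 2 * p with hc
  have hc0 : 0 ≤ c := by rw [hc]; linarith
  have hac : a ≤ c ^ 2 := by
    have h1 : ∑ i ∈ s, l i * binH (x i) ≤ phiF a := by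
      have := phiF_concave.le_map_sum hl hl1 hsqx
      simpa only [smul_eq_mul, phiF_sq] using this
    have h2 : binH p ≤ binH ((1 - Real.sqrt a) / 2) := hp.trans h1
    have hsa : Real.sqrt a ≤ 1 := Real.sqrt_le_one.2 ha1
    have := (binH_strictMonoOn.le_iff_le ⟨hp0, hp1⟩
      ⟨by linarith, by linarith [Real.sqrt_nonneg a]⟩).1 h2
    have h3 : Real.sqrt a ≤ c := by rw [hc]; linarith
    exact (Real.sqrt_le_left hc0).1 h3
  have hβc : β ≤ c := by
    have : β ^ 2 ≤ c ^ 2 := by nlinarith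
    exact le_of_sq_le_sq this hc0
  set W := ∑ i ∈ s, l i * (1 - 2 * ((x i + y i) / 2)) ^ 2 with hW
  have hWeq : W = (a + b + 2 * β) / 4 := by
    rw [hW, ha, hb, hβ, Finset.mul_sum, ← Finset.sum_add_distrib, ← Finset.sum_add_distrib,
      Finset.sum_div]
    exact Finset.sum_congr rfl fun i _ => by ring
  have hsqw : ∀ i ∈ s, (1 - 2 * ((x i + y i) / 2)) ^ 2 ∈ Set.Icc (0 : ℝ) 1 := fun i hi =>
    ⟨sq_nonneg _, by have := hy i hi; have := hx i hi; nlinarith [this.1, this.2, (hy i hi).1, (hy i hi).2]⟩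
  have hW0 : 0 ≤ W := Finset.sum_nonneg fun i hi => mul_nonneg (hl i hi) (sq_nonneg _)
  have hW1 : W ≤ 1 := by
    rw [← hl1]
    exact Finset.sum_le_sum fun i hi => by nlinarith [hl i hi, (hsqw i hi).2]
  have hsum : ∑ i ∈ s, l i * (2 * binH ((x i + y i) / 2) - (x i + y i - 2 * x i * y i)) ≤ KF W := by
    have h1 := KF_concave.le_map_sum hl hl1 hsqw
    simp only [smul_eq_mul] at h1
    refine le_trans (Finset.sum_le_sum fun i hi => ?_) h1
    apply mul_le_mul_of_nonneg_left _ (hl i hi)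
    rw [KF, phiF_sq]
    nlinarith [sq_nonneg (x i - y i)]
  refine ⟨by linarith, hsum.trans (KF_le W hW1 hW0), fun hη2 => hsum.trans ?_⟩
  rw [hβη]
  have hβ0 : 0 ≤ β := by linarith
  have hTW : TF c β ≤ W := by
    unfold TF
    rw [hWeq]
    rcases le_or_gt β (c ^ 2) with h | h
    · rw [max_eq_right (by linarith)]
      simp only [zero_div]
      nlinarith [sq_nonneg (a - b), sq_nonneg (a + b - 2 * β)]
    · rw [max_eq_left (by linarith)]
      have hβp : 0 < β := lt_of_le_of_lt (sq_nonneg c) h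
      have hap : 0 < a := by
        rcases ha0.eq_or_lt with h' | h'
        · rw [← h'] at hcs; nlinarith
        · exact h'
      have hcp : 0 < c := by
        rcases hc0.eq_or_lt with h' | h'
        · rw [← h'] at hac; nlinarith
        · exact h'
      have hb2 : β ^ 2 / a ≤ b := by rw [div_le_iff₀ hap]; linarith
      have key : c ^ 2 + β ^ 2 / c ^ 2 ≤ a + β ^ 2 / a := by
        have h3 : a * c ^ 2 ≤ β ^ 2 := by nlinarith [sq_nonneg c]
        have h4 : a + β ^ 2 / a - (c ^ 2 + β ^ 2 / c ^ 2) =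
            (c ^ 2 - a) * (β ^ 2 - a * c ^ 2) / (a * c ^ 2) := by
          field_simp; ring
        have h5 : 0 ≤ (c ^ 2 - a) * (β ^ 2 - a * c ^ 2) / (a * c ^ 2) :=
          div_nonneg (mul_nonneg (sub_nonneg.2 hac) (sub_nonneg.2 h3)) (by positivity)
        linarith
      have : β + ((β - c ^ 2) / (2 * c)) ^ 2 = (c ^ 2 + β ^ 2 / c ^ 2 + 2 * β) / 4 := by
        field_simp; ring
      rw [this]; linarith
  have hT0 : 0 ≤ TF c β := by unfold TF; positivity
  exact KF_antitone ⟨hT0, hTW.trans hW1⟩ ⟨hW0, hW1⟩ hTW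


open Classical in
/-- Counting binary words with a given property. -/
noncomputable def cntW {n : ℕ} (P : (Fin n → Fin 2) → Prop) : ℕ :=
  (Finset.univ.filter P).card

lemma cntW_mono {n : ℕ} {P Q : (Fin n → Fin 2) → Prop} (h : ∀ x, P x → Q x) : cntW P ≤ cntW Q := by
  classical
  unfold cntW
  exact Finset.card_le_card (Finset.monotone_filter_right _ (fun x _ hx => h x hx))

lemma cntW_eq_zero {n : ℕ} {P : (Fin n → Fin 2) → Prop} (h : ∀ x, ¬ P x) : cntW P = 0 := by
  classical
  unfold cntW
  exact Finset.card_eq_zero.2 (Finset.eq_empty_of_forall_notMem fun x hx => h x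
    (Finset.mem_filter.1 hx).2)

lemma cntW_or_and {n : ℕ} (P Q : (Fin n → Fin 2) → Prop) :
    cntW (fun x => P x ∨ Q x) + cntW (fun x => P x ∧ Q x) = cntW P + cntW Q := by
  classical
  have h1 : cntW (fun x => P x ∨ Q x) = (Finset.univ.filter P ∪ Finset.univ.filter Q).card := by
    unfold cntW; congr 1; ext x; simp
  have h2 : cntW (fun x => P x ∧ Q x) = (Finset.univ.filter P ∩ Finset.univ.filter Q).card := by
    unfold cntW; congr 1; ext x; simp
  rw [h1, h2, Finset.card_union_add_card_inter]
  unfold cntW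
  congr

lemma cntW_succ {n : ℕ} (P : (Fin (n + 1) → Fin 2) → Prop) :
    cntW P = cntW (fun x => P (Fin.cons 0 x)) + cntW (fun x => P (Fin.cons 1 x)) := by
  classical
  unfold cntW
  have h := Finset.card_filter_add_card_filter_not (s := Finset.univ.filter P) (fun x => x 0 = 0)
  rw [← h]
  congr 1
  · refine Finset.card_bij' (fun x _ => Fin.tail x) (fun x _ => Fin.cons 0 x) ?_ ?_ ?_ ?_
    · intro x hx
      simp only [Finset.mem_filter, Finset.mem_univ, true_and] at hx ⊢
      rw [← hx.2, Fin.cons_self_tail]; exact hx.1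
    · intro x hx
      simpa using hx
    · intro x hx
      simp only [Finset.mem_filter, Finset.mem_univ, true_and] at hx ⊢
      rw [← hx.2, Fin.cons_self_tail]
    · intro x hx
      simp
  · refine Finset.card_bij' (fun x _ => Fin.tail x) (fun x _ => Fin.cons 1 x) ?_ ?_ ?_ ?_
    · intro x hx
      simp only [Finset.mem_filter, Finset.mem_univ, true_and] at hx ⊢
      have : x 0 = 1 := by have := hx.2; omega
      rw [← this, Fin.cons_self_tail]; exact hx.1
    · intro x hx
      simpa using hx
    · intro x hx
      simp only [Finset.mem_filter, Finset.mem_univ, true_and] at hx ⊢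
      have : x 0 = 1 := by have := hx.2; omega
      rw [← this, Fin.cons_self_tail]
    · intro x hx
      simp

/-- Down-shifting: soft Sauer-Perles-Shelah. -/
lemma soft_sauer_aux : ∀ (n : ℕ) (C : (Fin n → Fin 2) → Prop),
    ∃ D : (Fin n → Fin 2) → Prop, cntW D = cntW C ∧ ∀ (S : Fin n → Prop) (u : Fin n → Fin 2),
      cntW (fun x => D x ∧ ∀ i, S i → x i = 1) ≤ cntW (fun x => C x ∧ ∀ i, S i → x i = u i) := by
  intro n
  induction n with
  | zero =>
    intro C
    refine ⟨C, rfl, fun S u => cntW_mono fun x hx => ⟨hx.1, fun i => i.elim0⟩⟩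
  | succ n ih =>
    intro C
    obtain ⟨D1, hD1, hS1⟩ := ih (fun x => C (Fin.cons 0 x) ∨ C (Fin.cons 1 x))
    obtain ⟨D2, hD2, hS2⟩ := ih (fun x => C (Fin.cons 0 x) ∧ C (Fin.cons 1 x))
    refine ⟨fun z => (z 0 = 0 ∧ D1 (Fin.tail z)) ∨ (z 0 = 1 ∧ D2 (Fin.tail z)), ?_, ?_⟩
    · rw [cntW_succ, cntW_succ C]
      simp only [Fin.cons_zero, Fin.tail_cons, true_and, Fin.isValue, zero_ne_one, one_ne_zero,
        false_and, or_false, false_or]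
      rw [← cntW_or_and (fun x => C (Fin.cons 0 x)), ← hD1, ← hD2]
    · intro S u
      rw [cntW_succ, cntW_succ (fun x => C x ∧ ∀ i, S i → x i = u i)]
      simp only [Fin.cons_zero, Fin.tail_cons, true_and, Fin.isValue, zero_ne_one, one_ne_zero,
        false_and, or_false, false_or, Fin.forall_fin_succ, Fin.cons_succ]
      have h1 := hS1 (fun i => S i.succ) (fun i => u i.succ)
      have h2 := hS2 (fun i => S i.succ) (fun i => u i.succ)
      by_cases h0 : S 0
      · have hz : cntW (fun x => D1 x ∧ (S 0 → False) ∧ ∀ i : Fin n, S i.succ → x i = 1) = 0 := 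
          cntW_eq_zero fun x hx => hx.2.1 h0
        rw [hz, zero_add]
        have hu : u 0 = 0 ∨ u 0 = 1 := by omega
        refine le_trans (cntW_mono fun x hx => ⟨hx.1, hx.2.2⟩) (h2.trans ?_)
        rcases hu with hu | hu
        · refine le_trans ?_ (Nat.le_add_right _ _)
          exact cntW_mono fun x hx => ⟨hx.1.1, fun _ => hu.symm, hx.2⟩
        · refine le_trans ?_ (Nat.le_add_left _ _)
          exact cntW_mono fun x hx => ⟨hx.1.2, fun _ => hu.symm, hx.2⟩
      · simp only [h0, false_imp_iff, true_and]
        refine (add_le_add h1 h2).trans ?_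
        rw [← cntW_or_and (fun x => C (Fin.cons 0 x) ∧ _)]
        apply add_le_add
        · exact cntW_mono fun x hx => by tauto
        · exact cntW_mono fun x hx => by tauto

/-- The support of a binary word. -/
def suppW {n : ℕ} (x : Fin n → Fin 2) : Finset (Fin n) := Finset.univ.filter fun i => x i = 1

lemma suppW_inj {n : ℕ} : Function.Injective (suppW (n := n)) := by
  intro x y h
  funext i
  have : i ∈ suppW x ↔ i ∈ suppW y := by rw [h]
  simp only [suppW, Finset.mem_filter, Finset.mem_univ, true_and] at this
  omega

lemma soft_sauer {n : ℕ} (C : Finset (Fin n → Fin 2)) (d s : ℕ) (hs : s ≤ n) :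
    ∃ S : Finset (Fin n), S.card = s ∧ ∀ u : Fin n → Fin 2,
      (C.card - ∑ k ∈ Finset.range d, n.choose k) * d.choose s ≤
        n.choose s * (C.filter fun x => ∀ i ∈ S, x i = u i).card := by
  classical
  obtain ⟨D, hD, hS⟩ := soft_sauer_aux n (fun x => x ∈ C)
  set DD := Finset.univ.filter D with hDD
  have hDc : DD.card = C.card := by
    have : cntW (fun x => x ∈ C) = C.card := by
      unfold cntW; congr 1; ext x; simp
    rw [← this, ← hD, cntW, hDD]
  set low := ∑ k ∈ Finset.range d, n.choose k
  set H := DD.filter (fun x => d ≤ (suppW x).card) with hH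
  have hlow : (DD.filter (fun x => ¬ d ≤ (suppW x).card)).card ≤ low := by
    calc _ ≤ ((Finset.range d).biUnion fun k => Finset.powersetCard k (Finset.univ : Finset (Fin n))).card := by
          refine Finset.card_le_card_of_injOn suppW ?_ (suppW_inj.injOn)
          intro x hx
          simp only [Finset.coe_filter, Set.mem_ofPred_eq, not_le] at hx
          simp only [Finset.coe_biUnion, Finset.coe_range, Set.mem_Iio, Set.mem_iUnion, Finset.mem_coe,
            Finset.mem_powersetCard]
          exact ⟨_, hx.2, Finset.subset_univ _, rfl⟩
      _ ≤ ∑ k ∈ Finset.range d, (Finset.powersetCard k (Finset.univ : Finset (Fin n))).card :=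
          Finset.card_biUnion_le
      _ = low := by simp [low]
  have hHc : C.card - low ≤ H.card := by
    have := Finset.card_filter_add_card_filter_not (s := DD) (fun x => d ≤ (suppW x).card)
    rw [hDc] at this
    rw [hH]
    omega
  set PS := Finset.powersetCard s (Finset.univ : Finset (Fin n)) with hPS
  have hPSc : PS.card = n.choose s := by simp [hPS]
  have hcount : ∑ S ∈ PS, (H.filter fun x => S ⊆ suppW x).card = ∑ x ∈ H, (suppW x).card.choose s := by
    have := Finset.sum_card_bipartiteAbove_eq_sum_card_bipartiteBelow (s := PS) (t := H)
      (fun S x => S ⊆ suppW x)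
    unfold Finset.bipartiteAbove Finset.bipartiteBelow at this
    rw [this]
    refine Finset.sum_congr rfl fun x _ => ?_
    rw [← Finset.card_powersetCard]
    congr 1
    ext S
    simp only [hPS, Finset.mem_filter, Finset.mem_powersetCard, Finset.subset_univ, true_and]
    tauto
  have hge : H.card * d.choose s ≤ ∑ S ∈ PS, (H.filter fun x => S ⊆ suppW x).card := by
    rw [hcount, ← smul_eq_mul]
    apply Finset.card_nsmul_le_sum
    intro x hx
    exact Nat.choose_le_choose s (Finset.mem_filter.1 hx).2
  have hne : PS.Nonempty := by
    rw [← Finset.card_pos, hPSc]; exact Nat.choose_pos hs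
  obtain ⟨S, hSm, hSle⟩ : ∃ S ∈ PS, H.card * d.choose s ≤
      n.choose s * (H.filter fun x => S ⊆ suppW x).card := by
    apply Finset.exists_le_of_sum_le hne
    rw [Finset.sum_const, hPSc, ← Finset.mul_sum, smul_eq_mul]
    exact Nat.mul_le_mul_left _ hge
  refine ⟨S, (Finset.mem_powersetCard.1 hSm).2, fun u => ?_⟩
  calc _ ≤ H.card * d.choose s := Nat.mul_le_mul_right _ hHc
    _ ≤ _ := hSle
    _ ≤ _ := by
      apply Nat.mul_le_mul_left
      have h1 := hS (fun i => i ∈ S) u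
      refine le_trans ?_ (h1.trans ?_)
      · unfold cntW
        apply Finset.card_le_card
        intro x hx
        simp only [hH, hDD, Finset.mem_filter, Finset.mem_univ, true_and] at hx ⊢
        refine ⟨hx.1.1, fun i hi => ?_⟩
        have := hx.2 hi
        simpa [suppW] using this
      · unfold cntW
        apply Finset.card_le_card
        intro x hx
        simpa using hx

lemma exp_binEntropy {n d : ℕ} (hd0 : 0 < d) (hdn : d < n) :
    Real.exp (n * Real.binEntropy ((d : ℝ) / n)) *
      (((d : ℝ) / n) ^ d * (1 - (d : ℝ) / n) ^ (n - d)) = 1 := by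
  have hn : (0 : ℝ) < n := by exact_mod_cast hd0.trans hdn
  have hq0 : 0 < (d : ℝ) / n := by positivity
  have hq1 : 0 < 1 - (d : ℝ) / n := by
    rw [sub_pos, div_lt_one hn]; exact_mod_cast hdn
  have e1 : ((d : ℝ) / n) ^ d = Real.exp (d * Real.log ((d : ℝ) / n)) := by
    rw [Real.exp_nat_mul, Real.exp_log hq0]
  have e2 : (1 - (d : ℝ) / n) ^ (n - d) = Real.exp (((n : ℝ) - d) * Real.log (1 - (d : ℝ) / n)) := by
    rw [← Nat.cast_sub hdn.le, Real.exp_nat_mul, Real.exp_log hq1]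
  rw [e1, e2, ← Real.exp_add, ← Real.exp_add, Real.exp_eq_one_iff,
    Real.binEntropy, Real.log_inv, Real.log_inv]
  field_simp
  ring

lemma sum_choose_le {n d : ℕ} (hd : 2 * d ≤ n) :
    (∑ k ∈ Finset.range (d + 1), (n.choose k : ℝ)) ≤
      Real.exp (n * Real.binEntropy ((d : ℝ) / n)) := by
  rcases Nat.eq_zero_or_pos d with rfl | hd0
  · simp
  have hdn : d < n := by omega
  have hn : (0 : ℝ) < n := by exact_mod_cast hd0.trans hdn
  set q := (d : ℝ) / n with hq
  have hq0 : 0 < q := by positivity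
  have hq1 : q ≤ 1 - q := by
    have : q ≤ 1 / 2 := by
      rw [hq, div_le_div_iff₀ hn (by norm_num)]; exact_mod_cast (by omega)
    linarith
  have key := exp_binEntropy hd0 hdn
  rw [← hq] at key
  set E := Real.exp (n * Real.binEntropy q)
  have h1 : (∑ k ∈ Finset.range (d + 1), (n.choose k : ℝ)) * (q ^ d * (1 - q) ^ (n - d)) ≤ 1 := by
    calc _ = ∑ k ∈ Finset.range (d + 1), (n.choose k : ℝ) * (q ^ d * (1 - q) ^ (n - d)) := by
          rw [Finset.sum_mul]
      _ ≤ ∑ k ∈ Finset.range (d + 1), q ^ k * (1 - q) ^ (n - k) * n.choose k := by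
          apply Finset.sum_le_sum
          intro k hk
          have hk' : k ≤ d := by simpa [Nat.lt_succ_iff] using hk
          rw [mul_comm]
          apply mul_le_mul_of_nonneg_right _ (Nat.cast_nonneg _)
          have e1 : q ^ d = q ^ k * q ^ (d - k) := by rw [← pow_add]; congr 1; omega
          have e2 : (1 - q) ^ (n - k) = (1 - q) ^ (d - k) * (1 - q) ^ (n - d) := by
            rw [← pow_add]; congr 1; omega
          rw [e1, e2, mul_assoc]
          have : q ^ (d - k) ≤ (1 - q) ^ (d - k) := pow_le_pow_left₀ hq0.le hq1 _
          have h3 : 0 ≤ (1 - q) ^ (n - d) := pow_nonneg (by linarith) _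
          gcongr
      _ ≤ ∑ k ∈ Finset.range (n + 1), q ^ k * (1 - q) ^ (n - k) * n.choose k := by
          apply Finset.sum_le_sum_of_subset_of_nonneg
          · exact Finset.range_mono (by omega)
          · intro k _ _
            have : 0 ≤ 1 - q := by linarith
            positivity
      _ = (q + (1 - q)) ^ n := (add_pow _ _ _).symm
      _ = 1 := by simp
  have hpos : 0 < q ^ d * (1 - q) ^ (n - d) := by
    have : 0 < 1 - q := by linarith
    positivity
  exact le_of_mul_le_mul_right (h1.trans_eq key.symm) hpos

lemma fact_pow_le (d k : ℕ) : d.factorial * d ^ k ≤ k.factorial * d ^ d := by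
  rcases le_total d k with h | h
  · have := Nat.factorial_mul_pow_sub_le_factorial h
    calc d.factorial * d ^ k = (d.factorial * d ^ (k - d)) * d ^ d := by
          rw [mul_assoc, ← pow_add]; congr 2; omega
      _ ≤ _ := Nat.mul_le_mul_right _ this
  · have := Nat.factorial_mul_factorial_dvd_factorial h
    have h2 : d.factorial ≤ k.factorial * d ^ (d - k) := by
      have := Nat.factorial_mul_descFactorial (n := d) (k := d - k) (by omega)
      rw [← this]
      have e : d - (d - k) = k := by omega
      rw [e]
      exact Nat.mul_le_mul_left _ (Nat.descFactorial_le_pow _ _)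
    calc d.factorial * d ^ k ≤ (k.factorial * d ^ (d - k)) * d ^ k := Nat.mul_le_mul_right _ h2
      _ = _ := by rw [mul_assoc, ← pow_add]; congr 2; omega

lemma choose_ge {n d : ℕ} (hd : d ≤ n) :
    Real.exp (n * Real.binEntropy ((d : ℝ) / n)) ≤ (n + 1) * (n.choose d : ℝ) := by
  rcases Nat.eq_zero_or_pos d with rfl | hd0
  · simp
  rcases hd.eq_or_lt with rfl | hdn
  · have : (d : ℝ) / d = 1 := div_self (by positivity)
    simp [this]
  have hn : (0 : ℝ) < n := by exact_mod_cast hd0.trans hdn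
  have key := exp_binEntropy hd0 hdn
  set q := (d : ℝ) / n with hq
  have hq0 : 0 < q := by positivity
  have hq1 : 0 < 1 - q := by
    rw [sub_pos, div_lt_one hn]; exact_mod_cast hdn
  set E := Real.exp (n * Real.binEntropy q)
  have hmode : ∀ k ∈ Finset.range (n + 1), q ^ k * (1 - q) ^ (n - k) * (n.choose k : ℝ) ≤
      q ^ d * (1 - q) ^ (n - d) * n.choose d := by
    intro k hk
    have hk' : k ≤ n := by simpa [Nat.lt_succ_iff] using hk
    have hnat : d ^ k * (n - d) ^ (n - k) * n.choose k ≤ d ^ d * (n - d) ^ (n - d) * n.choose d := by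
      have c1 := Nat.choose_mul_factorial_mul_factorial hk'
      have c2 := Nat.choose_mul_factorial_mul_factorial hd
      have f1 := fact_pow_le d k
      have f2 := fact_pow_le (n - d) (n - k)
      have f3 := Nat.mul_le_mul f1 f2
      have hp : 0 < k.factorial * (n - k).factorial * (d.factorial * (n - d).factorial) := by positivity
      apply le_of_mul_le_mul_right _ hp
      calc _ = (n.choose k * k.factorial * (n - k).factorial) *
            (d.factorial * d ^ k * ((n - d).factorial * (n - d) ^ (n - k))) := by ring
        _ ≤ (n.choose k * k.factorial * (n - k).factorial) *
            (k.factorial * d ^ d * ((n - k).factorial * (n - d) ^ (n - d))) := Nat.mul_le_mul_left _ f3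
        _ = (n.choose d * d.factorial * (n - d).factorial) *
            (k.factorial * d ^ d * ((n - k).factorial * (n - d) ^ (n - d))) := by rw [c1, c2]
        _ = _ := by ring
    have hr : (d : ℝ) ^ k * ((n : ℝ) - d) ^ (n - k) * n.choose k ≤
        (d : ℝ) ^ d * ((n : ℝ) - d) ^ (n - d) * n.choose d := by
      rw [← Nat.cast_sub hd]; exact_mod_cast hnat
    have e1 : 1 - q = ((n : ℝ) - d) / n := by rw [hq]; field_simp
    have conv : ∀ j ≤ n, q ^ j * (1 - q) ^ (n - j) = (d : ℝ) ^ j * ((n : ℝ) - d) ^ (n - j) / n ^ n := by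
      intro j hj
      rw [e1, hq, div_pow, div_pow, div_mul_div_comm, ← pow_add]
      congr 2; omega
    rw [conv k hk', conv d hd, div_mul_eq_mul_div, div_mul_eq_mul_div]
    gcongr
  have h1 : 1 ≤ (n + 1) * (q ^ d * (1 - q) ^ (n - d) * (n.choose d : ℝ)) := by
    have h2 : ∑ k ∈ Finset.range (n + 1), q ^ k * (1 - q) ^ (n - k) * (n.choose k : ℝ) = 1 := by
      rw [← add_pow]; simp
    have h3 := Finset.sum_le_card_nsmul _ _ _ hmode
    rw [h2] at h3
    simpa using h3
  calc E = E * 1 := (mul_one _).symm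
    _ ≤ E * ((n + 1) * (q ^ d * (1 - q) ^ (n - d) * (n.choose d : ℝ))) := by
      apply mul_le_mul_of_nonneg_left h1 (Real.exp_pos _).le
    _ = (E * (q ^ d * (1 - q) ^ (n - d))) * ((n + 1) * (n.choose d : ℝ)) := by ring
    _ = _ := by rw [key, one_mul]


/-- Gibbs inequality for a uniform distribution against a product distribution. -/
lemma gibbs {γ ι β : Type*} [Fintype ι] [DecidableEq ι] [DecidableEq β] (Ω : Finset γ)
    (hne : Ω.Nonempty) (B : Finset β) (f : γ → ι → β) (hf : Set.InjOn f Ω) (hB : ∀ ω ∈ Ω, ∀ i, f ω i ∈ B)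
    (Q : ι → β → ℝ) (hQ0 : ∀ i b, 0 ≤ Q i b) (hQ1 : ∀ i, ∑ b ∈ B, Q i b ≤ 1)
    (hpos : ∀ ω ∈ Ω, ∀ i, 0 < Q i (f ω i)) :
    (Ω.card : ℝ) * Real.log Ω.card ≤ ∑ ω ∈ Ω, ∑ i, -Real.log (Q i (f ω i)) := by
  have hN : (0 : ℝ) < Ω.card := by exact_mod_cast hne.card_pos
  have h1 : ∑ ω ∈ Ω, ∏ i, Q i (f ω i) ≤ 1 := by
    calc _ = ∑ z ∈ Ω.image f, ∏ i, Q i (z i) := by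
          rw [Finset.sum_image hf]
      _ ≤ ∑ z ∈ Fintype.piFinset (fun _ => B), ∏ i, Q i (z i) := by
          apply Finset.sum_le_sum_of_subset_of_nonneg
          · intro z hz
            obtain ⟨ω, hω, rfl⟩ := Finset.mem_image.1 hz
            exact Fintype.mem_piFinset.2 (hB ω hω)
          · intro z _ _
            exact Finset.prod_nonneg fun i _ => hQ0 _ _
      _ = ∏ i, ∑ b ∈ B, Q i b := by rw [Finset.prod_univ_sum]
      _ ≤ 1 := Finset.prod_le_one (fun i _ => Finset.sum_nonneg fun b _ => hQ0 i b) (fun i _ => hQ1 i)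
  have h2 : ∀ ω ∈ Ω, Real.log Ω.card - ∑ i, -Real.log (Q i (f ω i)) ≤
      Ω.card * ∏ i, Q i (f ω i) - 1 := by
    intro ω hω
    have hp : 0 < ∏ i, Q i (f ω i) := Finset.prod_pos fun i _ => hpos ω hω i
    have := Real.log_le_sub_one_of_pos (mul_pos hN hp)
    rw [Real.log_mul hN.ne' hp.ne', Real.log_prod (fun i _ => (hpos ω hω i).ne')] at this
    rw [Finset.sum_neg_distrib]
    linarith
  have h3 := Finset.sum_le_sum h2
  rw [Finset.sum_sub_distrib, Finset.sum_sub_distrib, ← Finset.mul_sum] at h3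
  simp only [Finset.sum_const, nsmul_eq_mul, mul_one] at h3
  nlinarith

/-- Real value of a bit. -/
def bt {n : ℕ} (a : Fin n → Fin 2) (i : Fin n) : ℝ := ((a i : ℕ) : ℝ)

lemma bt_cases {n : ℕ} (a : Fin n → Fin 2) (i : Fin n) :
    (bt a i = 0 ∧ (a i : ℕ) = 0) ∨ (bt a i = 1 ∧ (a i : ℕ) = 1) := by
  unfold bt
  have : (a i : ℕ) = 0 ∨ (a i : ℕ) = 1 := by omega
  rcases this with h | h <;> simp [h]

lemma bt_nonneg {n : ℕ} (a : Fin n → Fin 2) (i : Fin n) : 0 ≤ bt a i := by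
  rcases bt_cases a i with h | h <;> rw [h.1] <;> norm_num

lemma bt_le {n : ℕ} (a : Fin n → Fin 2) (i : Fin n) : bt a i ≤ 1 := by
  rcases bt_cases a i with h | h <;> rw [h.1]
  norm_num

/-- The mean of a bit over a finite set. -/
noncomputable def mn {n : ℕ} (A : Finset (Fin n → Fin 2)) (i : Fin n) : ℝ :=
  (∑ a ∈ A, bt a i) / A.card

lemma mn_mul {n : ℕ} (A : Finset (Fin n → Fin 2)) (i : Fin n) :
    A.card * mn A i = ∑ a ∈ A, bt a i := by
  unfold mn
  rcases A.eq_empty_or_nonempty with rfl | h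
  · simp
  · have : (A.card : ℝ) ≠ 0 := by exact_mod_cast h.card_pos.ne'
    field_simp

lemma mn_mem {n : ℕ} (A : Finset (Fin n → Fin 2)) (i : Fin n) : mn A i ∈ Set.Icc (0 : ℝ) 1 := by
  unfold mn
  have h0 : 0 ≤ ∑ a ∈ A, bt a i := Finset.sum_nonneg fun a _ => bt_nonneg a i
  refine ⟨by positivity, ?_⟩
  apply div_le_one_of_le₀ _ (Nat.cast_nonneg _)
  have := Finset.sum_le_card_nsmul A (fun a => bt a i) 1 (fun a _ => bt_le a i)
  simpa using this

lemma mn_pos {n : ℕ} {A : Finset (Fin n → Fin 2)} {a : Fin n → Fin 2} (ha : a ∈ A) {i : Fin n}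
    (h : bt a i = 1) : 0 < mn A i := by
  unfold mn
  have : bt a i ≤ ∑ a ∈ A, bt a i :=
    Finset.single_le_sum (f := fun a => bt a i) (fun a _ => bt_nonneg a i) ha
  have hc : (0 : ℝ) < A.card := by exact_mod_cast Finset.card_pos.2 ⟨a, ha⟩
  apply div_pos _ hc
  linarith

lemma mn_lt_one {n : ℕ} {A : Finset (Fin n → Fin 2)} {a : Fin n → Fin 2} (ha : a ∈ A) {i : Fin n}
    (h : bt a i = 0) : mn A i < 1 := by
  have hc : (0 : ℝ) < A.card := by exact_mod_cast Finset.card_pos.2 ⟨a, ha⟩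
  have h2 : 1 - bt a i ≤ ∑ a ∈ A, (1 - bt a i) :=
    Finset.single_le_sum (f := fun a => 1 - bt a i) (fun a _ => sub_nonneg.2 (bt_le a i)) ha
  rw [Finset.sum_sub_distrib] at h2
  simp only [Finset.sum_const, nsmul_eq_mul, mul_one] at h2
  unfold mn
  rw [div_lt_one hc]
  linarith

lemma marg_entropy {n : ℕ} (S : Finset (Fin n)) (A : Finset (Fin n → Fin 2)) (hA : A.Nonempty)
    (hinj : ∀ a ∈ A, ∀ a' ∈ A, (∀ i, i ∉ S → a i = a' i) → a = a') :
    Real.log A.card ≤ ∑ i : {i // i ∉ S}, Real.binEntropy (mn A i) := by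
  have hc : (0 : ℝ) < A.card := by exact_mod_cast hA.card_pos
  have hg := gibbs A hA (Finset.range 2) (fun a (i : {i // i ∉ S}) => (a i : ℕ))
    (by
      intro a ha a' ha' h
      refine hinj a ha a' ha' fun i hi => ?_
      have := congrFun h ⟨i, hi⟩
      simp only at this
      omega)
    (by intro a _ i; simp only [Finset.mem_range]; omega)
    (fun i k => if k = 0 then 1 - mn A i else mn A i)
    (by
      intro i b
      have := mn_mem A i
      split_ifs
      · linarith [this.2]
      · exact this.1)
    (by intro i; simp [Finset.sum_range_succ])
    (by
      intro a ha i
      rcases bt_cases a i with h | h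
      · simp only [h.2, if_true]; linarith [mn_lt_one ha h.1]
      · simp only [h.2, one_ne_zero, if_false]; exact mn_pos ha h.1)
  rw [Finset.sum_comm] at hg
  have key : ∀ i : {i // i ∉ S}, ∑ a ∈ A, -Real.log (if (a i : ℕ) = 0 then 1 - mn A i else mn A i) =
      A.card * Real.binEntropy (mn A i) := by
    intro i
    have e1 : ∀ a ∈ A, -Real.log (if (a i : ℕ) = 0 then 1 - mn A i else mn A i) =
        -Real.log (1 - mn A i) + bt a i * (Real.log (1 - mn A i) - Real.log (mn A i)) := by
      intro a _
      rcases bt_cases a i with h | h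
      · simp only [h.2, h.1, if_true]; ring
      · simp only [h.2, h.1, one_ne_zero, if_false]; ring
    rw [Finset.sum_congr rfl e1, Finset.sum_add_distrib, ← Finset.sum_mul, ← mn_mul,
      Real.binEntropy, Real.log_inv, Real.log_inv]
    simp only [Finset.sum_const, nsmul_eq_mul]
    ring
  rw [Finset.sum_congr rfl (fun i _ => key i), ← Finset.mul_sum] at hg
  exact le_of_mul_le_mul_left hg hc

lemma sum_entropy {n : ℕ} (S : Finset (Fin n)) (A B : Finset (Fin n → Fin 2)) (hA : A.Nonempty)
    (hB : B.Nonempty)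
    (hinj : ∀ a ∈ A, ∀ b ∈ B, ∀ a' ∈ A, ∀ b' ∈ B,
      (∀ i, i ∉ S → (a i : ℕ) + b i = a' i + b' i) → a = a' ∧ b = b') :
    Real.log (A.card * B.card) ≤ ∑ i : {i // i ∉ S}, (2 * Real.binEntropy ((mn A i + mn B i) / 2) -
      (mn A i + mn B i - 2 * mn A i * mn B i) * Real.log 2) := by
  have hcA : (0 : ℝ) < A.card := by exact_mod_cast hA.card_pos
  have hcB : (0 : ℝ) < B.card := by exact_mod_cast hB.card_pos
  set q : {i // i ∉ S} → ℝ := fun i => (mn A i + mn B i) / 2 with hq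
  have hq0 : ∀ i, 0 ≤ q i := fun i => by
    have := (mn_mem A i).1; have := (mn_mem B i).1; simp only [hq]; linarith
  have hq1 : ∀ i, q i ≤ 1 := fun i => by
    have := (mn_mem A i).2; have := (mn_mem B i).2; simp only [hq]; linarith
  have hqp : ∀ a ∈ A, ∀ b ∈ B, ∀ i : {i // i ∉ S}, bt a i = 1 ∨ bt b i = 1 → 0 < q i := by
    intro a ha b hb i h
    have h1 := (mn_mem A i).1; have h2 := (mn_mem B i).1; simp only [hq]
    rcases h with h | h
    · have := mn_pos ha h; linarith
    · have := mn_pos hb h; linarith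
  have hqn : ∀ a ∈ A, ∀ b ∈ B, ∀ i : {i // i ∉ S}, bt a i = 0 ∨ bt b i = 0 → 0 < 1 - q i := by
    intro a ha b hb i h
    have h1 := (mn_mem A i).2; have h2 := (mn_mem B i).2; simp only [hq]
    rcases h with h | h
    · have := mn_lt_one ha h; linarith
    · have := mn_lt_one hb h; linarith
  set Q : {i // i ∉ S} → ℕ → ℝ := fun i k =>
    if k = 0 then (1 - q i) ^ 2 else if k = 1 then 2 * (q i * (1 - q i)) else (q i) ^ 2 with hQ
  have hg := gibbs (A ×ˢ B) (hA.product hB) (Finset.range 3)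
    (fun ab (i : {i // i ∉ S}) => (ab.1 i : ℕ) + (ab.2 i : ℕ))
    (by
      rintro ⟨a, b⟩ hab ⟨a', b'⟩ hab' h
      simp only [Finset.coe_product, Set.mem_prod, Finset.mem_coe] at hab hab'
      obtain ⟨h1, h2⟩ := hinj a hab.1 b hab.2 a' hab'.1 b' hab'.2 fun i hi => congrFun h ⟨i, hi⟩
      rw [h1, h2])
    (by intro a _ i; simp only [Finset.mem_range]; omega)
    Q
    (by
      intro i b
      have := hq0 i
      have : 0 ≤ 1 - q i := sub_nonneg.2 (hq1 i)
      simp only [hQ]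
      split_ifs <;> positivity)
    (by intro i; simp [Finset.sum_range_succ, hQ]; apply le_of_eq; ring)
    (by
      rintro ⟨a, b⟩ hab i
      obtain ⟨ha, hb⟩ := Finset.mem_product.1 hab
      simp only at ha hb
      rcases bt_cases a i with h | h <;> rcases bt_cases b i with h' | h' <;>
        simp only [h.2, h'.2, hQ] <;> norm_num
      · exact pow_pos (hqn a ha b hb i (Or.inl h.1)) 2
      · exact mul_pos (hqp a ha b hb i (Or.inr h'.1)) (sub_pos.1 (hqn a ha b hb i (Or.inl h.1)) |> sub_pos.2)
      · exact mul_pos (hqp a ha b hb i (Or.inl h.1)) (sub_pos.1 (hqn a ha b hb i (Or.inr h'.1)) |> sub_pos.2)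
      · exact pow_pos (hqp a ha b hb i (Or.inl h.1)) 2)
  rw [Finset.sum_comm] at hg
  have key : ∀ i : {i // i ∉ S}, ∑ ab ∈ A ×ˢ B, -Real.log (Q i ((ab.1 i : ℕ) + (ab.2 i : ℕ))) =
      (A.card * B.card) * (2 * Real.binEntropy (q i) -
        (mn A i + mn B i - 2 * mn A i * mn B i) * Real.log 2) := by
    intro i
    have e1 : ∀ ab ∈ A ×ˢ B, -Real.log (Q i ((ab.1 i : ℕ) + (ab.2 i : ℕ))) =
        -(2 * Real.log (1 - q i)) +
        bt ab.1 i * (Real.log (1 - q i) - Real.log (q i) - Real.log 2) +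
        bt ab.2 i * (Real.log (1 - q i) - Real.log (q i) - Real.log 2) +
        bt ab.1 i * bt ab.2 i * (2 * Real.log 2) := by
      rintro ⟨a, b⟩ hab
      obtain ⟨ha, hb⟩ := Finset.mem_product.1 hab
      simp only at ha hb ⊢
      rcases bt_cases a i with h | h <;> rcases bt_cases b i with h' | h' <;>
        simp only [h.2, h'.2, hQ, h.1, h'.1] <;> norm_num
      · have h1 := hqp a ha b hb i (Or.inr h'.1)
        have h2 := hqn a ha b hb i (Or.inl h.1)
        rw [Real.log_mul (by norm_num) (by positivity), Real.log_mul h1.ne' h2.ne']; ring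
      · have h1 := hqp a ha b hb i (Or.inl h.1)
        have h2 := hqn a ha b hb i (Or.inr h'.1)
        rw [Real.log_mul (by norm_num) (by positivity), Real.log_mul h1.ne' h2.ne']; ring
      · ring
    rw [Finset.sum_congr rfl e1]
    simp only [Finset.sum_add_distrib, Finset.sum_product, Finset.sum_const, nsmul_eq_mul,
      ← Finset.sum_mul, ← Finset.mul_sum, ← mn_mul, Finset.card_product, Nat.cast_mul]
    rw [Real.binEntropy, Real.log_inv, Real.log_inv]
    have : q i = (mn A i + mn B i) / 2 := rfl
    have e2 : mn B i = 2 * q i - mn A i := by linarith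
    rw [e2]
    ring
  rw [Finset.sum_congr rfl (fun i _ => key i), ← Finset.mul_sum, Finset.card_product] at hg
  push_cast at hg
  exact le_of_mul_le_mul_left hg (by positivity)

lemma tot_entropy {n : ℕ} (S : Finset (Fin n)) {γ : Type*} (Ω : Finset γ) (hΩ : Ω.Nonempty)
    (fa fb : γ → Fin n → Fin 2)
    (hinj : ∀ w ∈ Ω, ∀ w' ∈ Ω,
      (∀ i, i ∉ S → (fa w i : ℕ) + fb w i = fa w' i + fb w' i) → w = w')
    (hS : 0 < Fintype.card {i // i ∉ S}) (η : ℝ)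
    (hη : Ω.card * Fintype.card {i // i ∉ S} * η = ∑ w ∈ Ω, ∑ i : {i // i ∉ S},
      (bt (fa w) i + bt (fb w) i - 2 * bt (fa w) i * bt (fb w) i)) :
    Real.log Ω.card ≤ Fintype.card {i // i ∉ S} * (Real.binEntropy η + (1 - η) * Real.log 2) := by
  have hc : (0 : ℝ) < Ω.card := by exact_mod_cast hΩ.card_pos
  have hS' : (0 : ℝ) < Fintype.card {i // i ∉ S} := by exact_mod_cast hS
  set κ : γ → {i // i ∉ S} → ℝ := fun w i =>
    bt (fa w) i + bt (fb w) i - 2 * bt (fa w) i * bt (fb w) i with hκ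
  have hκ0 : ∀ w i, 0 ≤ κ w i := by
    intro w i
    simp only [hκ]
    rcases bt_cases (fa w) i with h | h <;> rcases bt_cases (fb w) i with h' | h' <;>
      rw [h.1, h'.1] <;> norm_num
  have hκ1 : ∀ w i, κ w i ≤ 1 := by
    intro w i
    simp only [hκ]
    rcases bt_cases (fa w) i with h | h <;> rcases bt_cases (fb w) i with h' | h' <;>
      rw [h.1, h'.1] <;> norm_num
  have hs1 : ∑ w ∈ Ω, ∑ i : {i // i ∉ S}, (1 - κ w i) =
      Ω.card * Fintype.card {i // i ∉ S} * (1 - η) := by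
    have hη' : Ω.card * Fintype.card {i // i ∉ S} * η = ∑ w ∈ Ω, ∑ i : {i // i ∉ S}, κ w i := hη
    simp only [Finset.sum_sub_distrib]
    rw [mul_sub, hη']
    simp
  have hpos : 0 < (Ω.card : ℝ) * Fintype.card {i // i ∉ S} := by positivity
  have hη0 : 0 ≤ η := by
    have : 0 ≤ ∑ w ∈ Ω, ∑ i : {i // i ∉ S}, κ w i :=
      Finset.sum_nonneg fun w _ => Finset.sum_nonneg fun i _ => hκ0 w i
    rw [← hη] at this
    exact nonneg_of_mul_nonneg_right this hpos
  have hη1 : 0 ≤ 1 - η := by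
    have : 0 ≤ ∑ w ∈ Ω, ∑ i : {i // i ∉ S}, (1 - κ w i) :=
      Finset.sum_nonneg fun w _ => Finset.sum_nonneg fun i _ => sub_nonneg.2 (hκ1 w i)
    rw [hs1] at this
    exact nonneg_of_mul_nonneg_right this hpos
  have hηp : ∀ w ∈ Ω, ∀ i, κ w i = 1 → 0 < η := by
    intro w hw i h
    have h1 : ∑ i : {i // i ∉ S}, κ w i ≤ ∑ w ∈ Ω, ∑ i : {i // i ∉ S}, κ w i :=
      Finset.single_le_sum (f := fun w => ∑ i : {i // i ∉ S}, κ w i)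
        (fun w _ => Finset.sum_nonneg fun i _ => hκ0 w i) hw
    have h2 : κ w i ≤ ∑ i : {i // i ∉ S}, κ w i :=
      Finset.single_le_sum (f := fun i => κ w i) (fun i _ => hκ0 w i) (Finset.mem_univ i)
    rw [← hη] at h1
    exact pos_of_mul_pos_right (by linarith) hpos.le
  have hηn : ∀ w ∈ Ω, ∀ i, κ w i = 0 → 0 < 1 - η := by
    intro w hw i h
    have h1 : ∑ i : {i // i ∉ S}, (1 - κ w i) ≤ ∑ w ∈ Ω, ∑ i : {i // i ∉ S}, (1 - κ w i) :=
      Finset.single_le_sum (f := fun w => ∑ i : {i // i ∉ S}, (1 - κ w i))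
        (fun w _ => Finset.sum_nonneg fun i _ => sub_nonneg.2 (hκ1 w i)) hw
    have h2 : 1 - κ w i ≤ ∑ i : {i // i ∉ S}, (1 - κ w i) :=
      Finset.single_le_sum (f := fun i => 1 - κ w i) (fun i _ => sub_nonneg.2 (hκ1 w i))
        (Finset.mem_univ i)
    rw [hs1] at h1
    exact pos_of_mul_pos_right (by linarith) hpos.le
  set Q : {i // i ∉ S} → ℕ → ℝ := fun i k => if k = 1 then η else (1 - η) / 2 with hQ
  have hcase : ∀ w i, (κ w i = 1 ∧ (fa w i : ℕ) + (fb w i : ℕ) = 1) ∨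
      (κ w i = 0 ∧ (fa w i : ℕ) + (fb w i : ℕ) ≠ 1) := by
    intro w i
    simp only [hκ]
    rcases bt_cases (fa w) i with h | h <;> rcases bt_cases (fb w) i with h' | h' <;>
      rw [h.1, h'.1, h.2, h'.2] <;> norm_num
  have hg := gibbs Ω hΩ (Finset.range 3)
    (fun w (i : {i // i ∉ S}) => (fa w i : ℕ) + (fb w i : ℕ))
    (by
      intro w hw w' hw' h
      exact hinj w hw w' hw' fun i hi => congrFun h ⟨i, hi⟩)
    (by intro a _ i; simp only [Finset.mem_range]; omega)
    Q
    (by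
      intro i b
      simp only [hQ]
      split_ifs <;> linarith)
    (by intro i; simp [Finset.sum_range_succ, hQ]; apply le_of_eq; ring)
    (by
      intro w hw i
      rcases hcase w i with h | h
      · simp only [hQ, h.2, if_true]; exact hηp w hw i h.1
      · simp only [hQ, h.2, if_false]; linarith [hηn w hw i h.1])
  have e1 : ∀ w ∈ Ω, ∑ i : {i // i ∉ S}, -Real.log (Q i ((fa w i : ℕ) + (fb w i : ℕ))) =
      ∑ i : {i // i ∉ S}, (κ w i * (-Real.log η) + (1 - κ w i) * (Real.log 2 - Real.log (1 - η))) := by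
    intro w hw
    refine Finset.sum_congr rfl fun i _ => ?_
    rcases hcase w i with h | h
    · simp only [hQ, h.1, h.2, if_true]; ring
    · simp only [hQ, h.1, h.2, if_false]
      rw [Real.log_div (hηn w hw i h.1).ne' (by norm_num)]; ring
  rw [Finset.sum_congr rfl e1] at hg
  simp only [Finset.sum_add_distrib, ← Finset.sum_mul] at hg
  rw [hs1, ← hη] at hg
  apply le_of_mul_le_mul_left _ hc
  refine hg.trans (le_of_eq ?_)
  rw [Real.binEntropy, Real.log_inv, Real.log_inv]
  ring


lemma fiber_avg {W V : Type*} [Fintype V] [DecidableEq V] (C : Finset W) (ρ : W → V)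
    (F Y : V → ℝ) (r : W → ℝ)
    (hY : ∀ v, ((C.filter fun b => ρ b = v).card : ℝ) * Y v = ∑ b ∈ C.filter (fun b => ρ b = v), r b) :
    ∑ b ∈ C, F (ρ b) * r b = ∑ b ∈ C, F (ρ b) * Y (ρ b) := by
  rw [← Finset.sum_fiberwise C ρ, ← Finset.sum_fiberwise C ρ (fun b => F (ρ b) * Y (ρ b))]
  refine Finset.sum_congr rfl fun v _ => ?_
  have h1 : ∑ b ∈ C.filter (fun b => ρ b = v), F (ρ b) * r b =
      F v * ∑ b ∈ C.filter (fun b => ρ b = v), r b := by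
    rw [Finset.mul_sum]
    exact Finset.sum_congr rfl fun b hb => by rw [(Finset.mem_filter.1 hb).2]
  have h2 : ∑ b ∈ C.filter (fun b => ρ b = v), F (ρ b) * Y (ρ b) =
      ∑ b ∈ C.filter (fun b => ρ b = v), F v * Y v :=
    Finset.sum_congr rfl fun b hb => by rw [(Finset.mem_filter.1 hb).2]
  rw [h1, h2, ← hY, Finset.sum_const, nsmul_eq_mul]
  ring

lemma fiber_entropy {W V : Type*} [Fintype V] [Nonempty V] [DecidableEq V] (C : Finset W) (ρ : W → V) :
    (C.card : ℝ) * (Real.log C.card - Real.log (Fintype.card V)) ≤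
      ∑ b ∈ C, Real.log ((C.filter fun b' => ρ b' = ρ b).card : ℝ) := by
  rcases C.eq_empty_or_nonempty with rfl | hne
  · simp
  have hC : (0 : ℝ) < C.card := by exact_mod_cast hne.card_pos
  have hV : (0 : ℝ) < Fintype.card V := by exact_mod_cast Fintype.card_pos
  have hpos : ∀ b ∈ C, (0 : ℝ) < (C.filter fun b' => ρ b' = ρ b).card := fun b hb => by
    exact_mod_cast Finset.card_pos.2 ⟨b, by simp [hb]⟩
  have hs : ∑ b ∈ C, ((C.filter fun b' => ρ b' = ρ b).card : ℝ)⁻¹ ≤ Fintype.card V := by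
    rw [← Finset.sum_fiberwise C ρ]
    have : ∀ v ∈ (Finset.univ : Finset V), ∑ b ∈ C.filter (fun b => ρ b = v),
        ((C.filter fun b' => ρ b' = ρ b).card : ℝ)⁻¹ ≤ 1 := by
      intro v _
      have h2 : ∑ b ∈ C.filter (fun b => ρ b = v), ((C.filter fun b' => ρ b' = ρ b).card : ℝ)⁻¹ =
          ∑ b ∈ C.filter (fun b => ρ b = v), ((C.filter fun b' => ρ b' = v).card : ℝ)⁻¹ :=
        Finset.sum_congr rfl fun b hb => by rw [(Finset.mem_filter.1 hb).2]
      rw [h2, Finset.sum_const, nsmul_eq_mul]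
      exact mul_inv_le_one
    have := Finset.sum_le_card_nsmul _ _ _ this
    simpa using this
  have h1 : ∀ b ∈ C, Real.log C.card - Real.log (Fintype.card V) -
      Real.log ((C.filter fun b' => ρ b' = ρ b).card : ℝ) ≤
      C.card / Fintype.card V * ((C.filter fun b' => ρ b' = ρ b).card : ℝ)⁻¹ - 1 := by
    intro b hb
    have h := Real.log_le_sub_one_of_pos (mul_pos (div_pos hC hV) (inv_pos.2 (hpos b hb)))
    rw [Real.log_mul (div_pos hC hV).ne' (inv_pos.2 (hpos b hb)).ne', Real.log_div hC.ne' hV.ne',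
      Real.log_inv] at h
    linarith
  have h2 := Finset.sum_le_sum h1
  rw [Finset.sum_sub_distrib, Finset.sum_sub_distrib, Finset.sum_sub_distrib, ← Finset.mul_sum] at h2
  simp only [Finset.sum_const, nsmul_eq_mul, mul_one] at h2
  have h3 : (C.card : ℝ) / Fintype.card V * ∑ b ∈ C, ((C.filter fun b' => ρ b' = ρ b).card : ℝ)⁻¹ ≤
      C.card := by
    calc _ ≤ (C.card : ℝ) / Fintype.card V * Fintype.card V := by gcongr
      _ = _ := by field_simp
  linarith

lemma KF_TF_zero (c : ℝ) : KF (TF c 0) = 3 / 2 := by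
  have : TF c 0 = 0 := by
    unfold TF
    rw [max_eq_right (by nlinarith [sq_nonneg c])]
    simp
  rw [this]
  unfold KF phiF
  rw [Real.sqrt_zero, sub_zero, binH_half]; norm_num

lemma finite_bound {n : ℕ} (C1 C2 : Finset (Fin n → Fin 2)) (hze : ZeroErrorPair C1 C2)
    (hC2 : C2.Nonempty) (S : Finset (Fin n)) (hS : S.card < n) (M : ℕ) (hM : 0 < M)
    (hSM : ∀ u : Fin n → Fin 2, M ≤ (C1.filter fun x => ∀ i ∈ S, x i = u i).card)
    (p : ℝ) (hp0 : 0 ≤ p) (hp1 : p ≤ 1 / 2)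
    (hp : ((n : ℝ) - S.card) * Real.binEntropy p ≤ Real.log M) :
    ∃ η : ℝ, p ≤ η ∧ η ≤ 1 / 2 ∧
      (Real.log C2.card + Real.log M) / (((n : ℝ) - S.card) * Real.log 2) ≤ Lfun η ∧
      (Real.log C2.card + Real.log M) / (((n : ℝ) - S.card) * Real.log 2) ≤
        KF (TF (1 - 2 * p) (1 - 2 * η)) + S.card / ((n : ℝ) - S.card) := by
  classical
  set ι := {i // i ∉ S}
  have hcard : (Fintype.card ι : ℝ) = (n : ℝ) - S.card := by
    have : Fintype.card ι = n - S.card := by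
      simp [ι, Fintype.card_subtype_compl]
    rw [this, Nat.cast_sub hS.le]
  rw [← hcard] at hp ⊢
  set m : ℝ := (Fintype.card ι : ℝ) with hm
  have hm0 : 0 < m := by
    rw [hcard, sub_pos]; exact_mod_cast hS
  set V := (↥S → Fin 2)
  set ρ : (Fin n → Fin 2) → V := fun b i => b i with hρ
  have hVc : Real.log (Fintype.card V) = S.card * Real.log 2 := by
    simp [V, Real.log_pow]
  -- the sub-codebooks of the first user
  have hex : ∀ v : V, ∃ A : Finset (Fin n → Fin 2), A ⊆ C1 ∧ A.card = M ∧
      ∀ a ∈ A, ∀ i : ↥S, (a i : ℕ) + (v i : ℕ) = 1 := by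
    intro v
    obtain ⟨A, hA, hAc⟩ := Finset.exists_subset_card_eq
      (hSM (fun i => if h : i ∈ S then 1 - v ⟨i, h⟩ else 0))
    refine ⟨A, hA.trans (Finset.filter_subset _ _), hAc, fun a ha i => ?_⟩
    have h1 := (Finset.mem_filter.1 (hA ha)).2 i i.2
    simp only [i.2, dif_pos] at h1
    rw [h1]
    have : ∀ t : Fin 2, ((1 - t : Fin 2) : ℕ) + (t : ℕ) = 1 := by decide
    exact this _
  choose g hg1 hgc hgs using hex
  have hgne : ∀ v, (g v).Nonempty := fun v => Finset.card_pos.1 (by rw [hgc]; exact hM)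
  set B : V → Finset (Fin n → Fin 2) := fun v => C2.filter fun b => ρ b = v with hB
  -- the key injectivity
  have hinj : ∀ b ∈ C2, ∀ a ∈ g (ρ b), ∀ b' ∈ C2, ∀ a' ∈ g (ρ b'),
      (∀ i, i ∉ S → (a i : ℕ) + b i = a' i + b' i) → a = a' ∧ b = b' := by
    intro b hb a ha b' hb' a' ha' h
    have := hze (x₁ := (a, b)) (x₂ := (a', b')) (by simp [hg1 _ ha, hb]) (by simp [hg1 _ ha', hb'])
      (by
        funext i
        by_cases hi : i ∈ S
        · have e1 := hgs _ a ha ⟨i, hi⟩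
          have e2 := hgs _ a' ha' ⟨i, hi⟩
          simp only [hρ] at e1 e2
          simp only
          rw [e1, e2]
        · exact h i hi)
    simpa using this
  have hC : (0 : ℝ) < C2.card := by exact_mod_cast hC2.card_pos
  have hM' : (0 : ℝ) < M := by exact_mod_cast hM
  have hl2 := log_two_pos'
  set X : (Fin n → Fin 2) → ι → ℝ := fun b i => mn (g (ρ b)) i with hX
  set Y : (Fin n → Fin 2) → ι → ℝ := fun b i => mn (B (ρ b)) i with hY
  -- single codebook entropy
  have hE1 : ∀ b ∈ C2, Real.log M ≤ ∑ i, Real.binEntropy (X b i) := by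
    intro b hb
    have := marg_entropy S (g (ρ b)) (hgne _) (by
      intro a ha a' ha' h
      exact (hinj b hb a ha b hb a' ha' fun i hi => by rw [h i hi]).1)
    rw [hgc] at this
    exact this
  have hE2 : ∀ b ∈ C2, Real.log M + Real.log (B (ρ b)).card ≤ ∑ i,
      (2 * Real.binEntropy ((X b i + Y b i) / 2) - (X b i + Y b i - 2 * X b i * Y b i) * Real.log 2) := by
    intro b hb
    have hBne : (B (ρ b)).Nonempty := ⟨b, by simp [hB, hb]⟩
    have := sum_entropy S (g (ρ b)) (B (ρ b)) (hgne _) hBne (by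
      intro a ha b1 hb1 a' ha' b2 hb2 h
      simp only [hB, Finset.mem_filter] at hb1 hb2
      exact hinj b1 hb1.1 a (by rw [hb1.2]; exact ha) b2 hb2.1 a' (by rw [hb2.2]; exact ha') h)
    rw [hgc, Real.log_mul hM'.ne' (by exact_mod_cast hBne.card_pos.ne')] at this
    exact this
  set η : ℝ := ∑ bi ∈ C2 ×ˢ (Finset.univ : Finset ι),
    (1 / (C2.card * m)) * (X bi.1 bi.2 + Y bi.1 bi.2 - 2 * X bi.1 bi.2 * Y bi.1 bi.2) with hη
  have hηs : C2.card * m * η = ∑ b ∈ C2, ∑ i, (X b i + Y b i - 2 * X b i * Y b i) := by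
    rw [hη, ← Finset.mul_sum, Finset.sum_product, one_div, mul_inv_cancel_left₀ (by positivity)]
  have hE3 : Real.log C2.card + Real.log M ≤ m * (Real.binEntropy η + (1 - η) * Real.log 2) := by
    have hΩc : (C2.sigma fun b => g (ρ b)).card = C2.card * M := by
      rw [Finset.card_sigma, Finset.sum_congr rfl (fun b _ => hgc (ρ b))]
      simp
    have := tot_entropy S (C2.sigma fun b => g (ρ b))
      (by rw [← Finset.card_pos, hΩc]; exact Nat.mul_pos hC2.card_pos hM)
      (fun w => w.2) (fun w => w.1)
      (by
        rintro ⟨b, a⟩ hw ⟨b', a'⟩ hw' h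
        obtain ⟨hb, ha⟩ := Finset.mem_sigma.1 hw
        obtain ⟨hb', ha'⟩ := Finset.mem_sigma.1 hw'
        obtain ⟨h1, h2⟩ := hinj b hb a ha b' hb' a' ha' h
        subst h1 h2
        rfl)
      (by rw [hm] at hm0; exact Nat.cast_pos.1 hm0) η
      (by
        rw [hΩc, Finset.sum_sigma]
        push_cast
        have e1 : (C2.card : ℝ) * M * m * η = M * (C2.card * m * η) := by ring
        rw [← hm, e1, hηs, Finset.mul_sum]
        have e2 : ∀ b ∈ C2, ∑ a ∈ g (ρ b), ∑ i : ι, (bt a i + bt b i - 2 * bt a i * bt b i) =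
            ∑ i : ι, (M * X b i + (M - 2 * (M * X b i)) * bt b i) := by
          intro b _
          rw [Finset.sum_comm]
          refine Finset.sum_congr rfl fun i _ => ?_
          have e3 := mn_mul (g (ρ b)) i
          rw [hgc] at e3
          simp only [hX]
          rw [e3, Finset.sum_sub_distrib, Finset.sum_add_distrib, ← Finset.sum_mul, ← Finset.mul_sum]
          simp only [Finset.sum_const, nsmul_eq_mul, hgc]
          ring
        rw [Finset.sum_congr rfl e2]
        simp only [Finset.mul_sum]
        rw [Finset.sum_comm, Finset.sum_comm (s := C2)]
        refine Finset.sum_congr rfl fun i _ => ?_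
        rw [Finset.sum_add_distrib]
        rw [fiber_avg C2 ρ (fun v => (M - 2 * (M * mn (g v) i))) (fun v => mn (B v) i)
          (fun b => bt b i) (fun v => mn_mul _ _), ← Finset.sum_add_distrib]
        refine Finset.sum_congr rfl fun b _ => ?_
        simp only [hX, hY]
        ring)
    rw [hΩc] at this
    push_cast at this
    rw [Real.log_mul hC.ne' hM'.ne'] at this
    exact this
  have hl1 : ∑ bi ∈ C2 ×ˢ (Finset.univ : Finset ι), (1 / (C2.card * m)) = 1 := by
    rw [Finset.sum_const, Finset.card_product, nsmul_eq_mul, Finset.card_univ]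
    push_cast
    rw [← hm]
    field_simp
  obtain ⟨h1, h2, h3⟩ := avg_lemma (C2 ×ˢ (Finset.univ : Finset ι)) (fun _ => 1 / (C2.card * m))
    (fun bi => X bi.1 bi.2) (fun bi => Y bi.1 bi.2) (fun _ _ => by positivity) hl1
    (fun bi _ => mn_mem _ _) (fun bi _ => mn_mem _ _) p η hp0 hp1
    (by
      rw [← Finset.mul_sum, Finset.sum_product]
      have h4 : (C2.card : ℝ) * Real.log M ≤ ∑ b ∈ C2, ∑ i, Real.binEntropy (X b i) := by
        have := Finset.card_nsmul_le_sum C2 _ _ hE1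
        simpa using this
      simp only [binH_eq, ← Finset.sum_div]
      rw [one_div, ← div_eq_inv_mul, div_div, div_le_div_iff₀ hl2 (by positivity)]
      have h5 : (C2.card : ℝ) * (m * Real.binEntropy p) ≤ C2.card * Real.log M := by gcongr
      nlinarith) hη
  set G := ∑ bi ∈ C2 ×ˢ (Finset.univ : Finset ι), (1 / (C2.card * m)) *
    (2 * binH ((X bi.1 bi.2 + Y bi.1 bi.2) / 2) -
      (X bi.1 bi.2 + Y bi.1 bi.2 - 2 * X bi.1 bi.2 * Y bi.1 bi.2)) with hG
  have hGb : (Real.log C2.card + Real.log M) / (m * Real.log 2) ≤ G + S.card / m := by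
    have h4 := fiber_entropy C2 ρ
    rw [hVc] at h4
    have h5 := Finset.sum_le_sum hE2
    rw [Finset.sum_add_distrib, Finset.sum_const, nsmul_eq_mul] at h5
    have h6 : C2.card * m * Real.log 2 * G = ∑ b ∈ C2, ∑ i,
      (2 * Real.binEntropy ((X b i + Y b i) / 2) - (X b i + Y b i - 2 * X b i * Y b i) * Real.log 2) := by
      rw [hG, ← Finset.mul_sum, Finset.sum_product]
      have : (C2.card : ℝ) * m * Real.log 2 * (1 / (C2.card * m) * ∑ b ∈ C2, ∑ i : ι,
          (2 * binH ((X b i + Y b i) / 2) - (X b i + Y b i - 2 * X b i * Y b i))) =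
          Real.log 2 * ∑ b ∈ C2, ∑ i : ι,
          (2 * binH ((X b i + Y b i) / 2) - (X b i + Y b i - 2 * X b i * Y b i)) := by
        field_simp
      rw [this]
      simp only [Finset.mul_sum]
      refine Finset.sum_congr rfl fun b _ => Finset.sum_congr rfl fun i _ => ?_
      rw [binH_eq]
      field_simp
    rw [← h6] at h5
    have h7 : C2.card * (Real.log C2.card + Real.log M) ≤
        C2.card * (m * Real.log 2 * G + S.card * Real.log 2) := by linarith
    have h8 := le_of_mul_le_mul_left h7 hC
    rw [div_le_iff₀ (by positivity)]
    have : (G + S.card / m) * (m * Real.log 2) = m * Real.log 2 * G + S.card * Real.log 2 := by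
      field_simp
    linarith
  have hLb : (Real.log C2.card + Real.log M) / (m * Real.log 2) ≤ Lfun η := by
    rw [div_le_iff₀ (by positivity)]
    refine hE3.trans (le_of_eq ?_)
    rw [Lfun, binH_eq]
    field_simp
    ring
  rcases le_total η (1 / 2) with hh | hh
  · exact ⟨η, h1, hh, hLb, hGb.trans (by have := h3 hh; linarith)⟩
  · refine ⟨1 / 2, hp1, le_rfl, hLb.trans ?_, hGb.trans ?_⟩
    · unfold Lfun
      rw [binH_half]
      have := binH_le_one η
      linarith
    · have : (1 : ℝ) - 2 * (1 / 2) = 0 := by norm_num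
      rw [this, KF_TF_zero]
      linarith


lemma KF_TF_eq (p η : ℝ) (hp0 : 0 ≤ p) (hpη : p ≤ η) (hη : η ≤ 1 / 2) :
    KF (TF (1 - 2 * p) (1 - 2 * η)) = Jfun p η := by
  have hσ : star p p = 2 * p * (1 - p) := by unfold _root_.star; ring
  have hc2 : 1 - 2 * star p p = (1 - 2 * p) ^ 2 := by rw [hσ]; ring
  unfold Jfun
  split_ifs with h
  · have hT : TF (1 - 2 * p) (1 - 2 * η) = 1 - 2 * η := by
      unfold TF
      rw [max_eq_right (by rw [← hc2]; linarith)]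
      simp
    rw [hT]
    unfold KF phiF
    have e : (1 - √(1 - 2 * η)) / 2 = 1 / 2 * (1 - √(1 - 2 * η)) := by ring
    rw [e]
    ring
  · push Not at h
    have hc : 0 < 1 - 2 * p := by
      rcases lt_or_ge p (1 / 2) with h1 | h1
      · linarith
      · have : p = 1 / 2 := le_antisymm (hpη.trans hη) h1
        rw [hσ, this] at h
        linarith
    rw [hc2, Real.sqrt_sq hc.le]
    have hT : TF (1 - 2 * p) (1 - 2 * η) = ((1 - η - star p p) / (1 - 2 * p)) ^ 2 := by
      unfold TF
      rw [max_eq_left (by rw [← hc2]; linarith), hσ]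
      field_simp
      ring
    have hn : 0 ≤ (1 - η - star p p) / (1 - 2 * p) := by
      apply div_nonneg _ hc.le
      have : star p p ≤ 1 / 2 := by rw [hσ]; nlinarith [sq_nonneg (1 - 2 * p)]
      linarith
    rw [hT]
    unfold KF phiF
    rw [Real.sqrt_sq hn]
    have e : (1 - (1 - η - star p p) / (1 - 2 * p)) / 2 =
      1 / 2 * (1 - (1 - η - star p p) / (1 - 2 * p)) := by ring
    rw [e, div_pow]
    ring

lemma limit_step (p r0 ρ : ℝ) (hp0 : 0 ≤ p) (hp1 : p ≤ 1 / 2) (hr0 : 0 ≤ r0)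
    (H : ∀ τ : ℝ, 0 < τ → ∃ p' η : ℝ, |p' - p| < τ ∧ p' ≤ η ∧ η ≤ 1 / 2 ∧ ρ - τ ≤ Lfun η ∧
      ρ - τ ≤ KF (TF (1 - 2 * p') (1 - 2 * η)) + r0) :
    ∃ η : ℝ, p ≤ η ∧ η ≤ 1 / 2 ∧ ρ ≤ Lfun η ∧ ρ ≤ Jfun p η + r0 := by
  choose P E hP hPE hE hL hK using fun k : ℕ => H (1 / ((k : ℝ) + 1)) (by positivity)
  have ht : Filter.Tendsto (fun k : ℕ => 1 / ((k : ℝ) + 1)) Filter.atTop (nhds 0) :=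
    tendsto_one_div_add_atTop_nhds_zero_nat
  have hPt : Filter.Tendsto P Filter.atTop (nhds p) := by
    rw [tendsto_iff_dist_tendsto_zero]
    refine squeeze_zero (fun _ => dist_nonneg) (fun k => ?_) ht
    rw [Real.dist_eq]
    exact (hP k).le
  have hEb : ∀ k, E k ∈ Set.Icc (-1 : ℝ) (1 / 2) := fun k => by
    refine ⟨?_, hE k⟩
    have h1 := (abs_lt.1 (hP k)).1
    have h2 : 1 / ((k : ℝ) + 1) ≤ 1 := by
      rw [div_le_one (by positivity)]
      have : (0 : ℝ) ≤ k := Nat.cast_nonneg k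
      linarith
    linarith [hPE k]
  obtain ⟨η, hη, φ, hφ, hlim⟩ := isCompact_Icc.tendsto_subseq hEb
  have hPφ := hPt.comp hφ.tendsto_atTop
  have htφ := ht.comp hφ.tendsto_atTop
  have hρφ : Filter.Tendsto (fun k => ρ - 1 / ((φ k : ℝ) + 1)) Filter.atTop (nhds ρ) := by
    have := htφ.const_sub ρ
    simpa using this
  have hpη : p ≤ η := le_of_tendsto_of_tendsto' hPφ hlim fun k => hPE (φ k)
  have hLη : ρ ≤ Lfun η := by
    have hc : Continuous Lfun := by
      unfold Lfun
      have := binH_continuous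
      fun_prop
    exact le_of_tendsto_of_tendsto' hρφ ((hc.tendsto η).comp hlim) fun k => hL (φ k)
  refine ⟨η, hpη, hη.2, hLη, ?_⟩
  rw [← KF_TF_eq p η hp0 hpη hη.2]
  rcases hp1.lt_or_eq with hp | hp
  · have hT : Filter.Tendsto (fun k => TF (1 - 2 * P (φ k)) (1 - 2 * E (φ k))) Filter.atTop
        (nhds (TF (1 - 2 * p) (1 - 2 * η))) := by
      have a1 : Filter.Tendsto (fun k => 1 - 2 * P (φ k)) Filter.atTop (nhds (1 - 2 * p)) :=
        (hPφ.const_mul 2).const_sub 1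
      have a2 : Filter.Tendsto (fun k => 1 - 2 * E (φ k)) Filter.atTop (nhds (1 - 2 * η)) :=
        (hlim.const_mul 2).const_sub 1
      unfold TF
      refine a2.add (Filter.Tendsto.pow (Filter.Tendsto.div ?_ (a1.const_mul 2) ?_) 2)
      · exact (a2.sub (a1.pow 2)).max tendsto_const_nhds
      · have : 0 < 1 - 2 * p := by linarith
        positivity
    have := ((KF_continuous.tendsto _).comp hT).add_const r0
    exact le_of_tendsto_of_tendsto' hρφ this fun k => hK (φ k)
  · have hη2 : η = 1 / 2 := le_antisymm hη.2 (by linarith)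
    subst hη2
    have : (1 : ℝ) - 2 * (1 / 2) = 0 := by norm_num
    rw [this, KF_TF_zero]
    unfold Lfun at hLη
    rw [binH_half] at hLη
    linarith

lemma core {n : ℕ} (C1 C2 : Finset (Fin n → Fin 2)) (hze : ZeroErrorPair C1 C2)
    (hC2 : C2.Nonempty) (d s : ℕ) (hsd : s ≤ d) (hdn : 2 * d ≤ n) (hn : 0 < n)
    (hC1 : 2 * ((n : ℝ) + 1) * Real.exp (n * Real.binEntropy ((d : ℝ) / n)) ≤ C1.card) :
    ∃ η : ℝ, ((d : ℝ) - s) / (n - s) ≤ η ∧ η ≤ 1 / 2 ∧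
      Real.log C2.card / (((n : ℝ) - s) * Real.log 2) + binH (((d : ℝ) - s) / (n - s)) ≤ Lfun η ∧
      Real.log C2.card / (((n : ℝ) - s) * Real.log 2) + binH (((d : ℝ) - s) / (n - s)) ≤
        KF (TF (1 - 2 * (((d : ℝ) - s) / (n - s))) (1 - 2 * η)) + s / ((n : ℝ) - s) := by
  obtain ⟨S, hSc, hS⟩ := soft_sauer C1 d s (by omega)
  have hsn : s < n := by omega
  have hsnR : (0 : ℝ) < (n : ℝ) - s := by rw [sub_pos]; exact_mod_cast hsn
  have hsdR : (0 : ℝ) ≤ (d : ℝ) - s := by rw [sub_nonneg]; exact_mod_cast hsd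
  have hdnR : 2 * (d : ℝ) ≤ n := by exact_mod_cast hdn
  have hE := sum_choose_le hdn
  rw [Finset.sum_range_succ] at hE
  set E := Real.exp (n * Real.binEntropy ((d : ℝ) / n)) with hEdef
  have hEpos : 0 < E := Real.exp_pos _
  have hlow0 : (0 : ℝ) ≤ ∑ k ∈ Finset.range d, (n.choose k : ℝ) :=
    Finset.sum_nonneg fun _ _ => Nat.cast_nonneg _
  have hch0 : (0 : ℝ) ≤ (n.choose d : ℝ) := Nat.cast_nonneg _
  have hkey : (n + 1) * n.choose d ≤ C1.card - ∑ k ∈ Finset.range d, n.choose k := by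
    apply Nat.le_sub_of_add_le
    have : (((n + 1) * n.choose d + ∑ k ∈ Finset.range d, n.choose k : ℕ) : ℝ) ≤ C1.card := by
      push_cast
      have hn0 : (0 : ℝ) ≤ n := Nat.cast_nonneg n
      nlinarith [mul_nonneg hn0 hEpos.le, mul_nonneg hn0 hlow0,
        mul_le_mul_of_nonneg_left hE hn0]
    exact_mod_cast this
  have hcount : ∀ u : Fin n → Fin 2, (n + 1) * (n - s).choose (d - s) ≤
      (C1.filter fun x => ∀ i ∈ S, x i = u i).card := by
    intro u
    have h1 := (Nat.mul_le_mul_right (d.choose s) hkey).trans (hS u)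
    have h2 : (n + 1) * n.choose d * d.choose s =
        n.choose s * ((n + 1) * (n - s).choose (d - s)) := by
      rw [mul_assoc, Nat.choose_mul hsd]
      ring
    rw [h2] at h1
    exact Nat.le_of_mul_le_mul_left h1 (Nat.choose_pos hsn.le)
  have hMpos : 0 < (n + 1) * (n - s).choose (d - s) :=
    Nat.mul_pos (by omega) (Nat.choose_pos (by omega))
  have hcs : ((n - s : ℕ) : ℝ) = (n : ℝ) - s := Nat.cast_sub hsn.le
  have hcd : ((d - s : ℕ) : ℝ) = (d : ℝ) - s := Nat.cast_sub hsd
  set p : ℝ := ((d : ℝ) - s) / (n - s) with hpdef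
  have hp0 : 0 ≤ p := by positivity
  have hp1 : p ≤ 1 / 2 := by
    rw [hpdef, div_le_iff₀ hsnR]
    have : (0 : ℝ) ≤ s := Nat.cast_nonneg s
    linarith
  have hM : ((n : ℝ) - s) * Real.binEntropy p ≤
      Real.log (((n + 1) * (n - s).choose (d - s) : ℕ) : ℝ) := by
    rw [Real.le_log_iff_exp_le (by exact_mod_cast hMpos)]
    have h := choose_ge (n := n - s) (d := d - s) (by omega)
    rw [hcs, hcd] at h
    refine h.trans ?_
    push_cast
    gcongr
    have : (0 : ℝ) ≤ s := Nat.cast_nonneg s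
    linarith
  obtain ⟨η, h1, h2, h3, h4⟩ := finite_bound C1 C2 hze hC2 S (by omega) _ hMpos hcount p hp0 hp1
    (by rw [hSc]; exact hM)
  rw [hSc] at h3 h4
  have hl2 := log_two_pos'
  have hle : Real.log C2.card / (((n : ℝ) - s) * Real.log 2) + binH p ≤
      (Real.log C2.card + Real.log (((n + 1) * (n - s).choose (d - s) : ℕ) : ℝ)) /
        (((n : ℝ) - s) * Real.log 2) := by
    rw [add_div]
    gcongr
    rw [binH_eq, div_le_div_iff₀ hl2 (by positivity)]
    nlinarith
  exact ⟨η, h1, h2, hle.trans h3, hle.trans h4⟩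


lemma admissible_le_one {R1 R2 : ℝ} (h : Admissible R1 R2) : R1 ≤ 1 := by
  by_contra hR
  push Not at hR
  obtain ⟨n, hn, C1, C2, -, h1, -⟩ := h.2.2 ((R1 - 1) / 2) (by linarith) 1
  have hc : (C1.card : ℝ) ≤ (2 : ℝ) ^ (n : ℝ) := by
    have := Finset.card_le_univ C1
    simp only [Fintype.card_fun, Fintype.card_fin] at this
    rw [Real.rpow_natCast]
    exact_mod_cast this
  have h2 := h1.trans hc
  rw [Real.rpow_le_rpow_left_iff (by norm_num)] at h2
  have hn' : (1 : ℝ) ≤ n := by exact_mod_cast hn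
  nlinarith

lemma log_card_ge {n : ℕ} {R : ℝ} {C : Finset (Fin n → Fin 2)}
    (h : (2 : ℝ) ^ ((n : ℝ) * R) ≤ C.card) : n * R * Real.log 2 ≤ Real.log C.card := by
  have := Real.log_le_log (Real.rpow_pos_of_pos two_pos _) h
  rwa [Real.log_rpow two_pos] at this

lemma card_nonempty {n : ℕ} {R : ℝ} {C : Finset (Fin n → Fin 2)}
    (h : (2 : ℝ) ^ ((n : ℝ) * R) ≤ C.card) : C.Nonempty := by
  have := (Real.rpow_pos_of_pos (two_pos : (0:ℝ) < 2) ((n : ℝ) * R)).trans_le h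
  exact Finset.card_pos.1 (by exact_mod_cast this)

lemma approx_zero {R1 R2 : ℝ} (h : Admissible R1 R2) (τ : ℝ) (hτ : 0 < τ) :
    ∃ η : ℝ, 0 ≤ η ∧ η ≤ 1 / 2 ∧ R2 - τ ≤ Lfun η ∧ R2 - τ ≤ KF (TF (1 - 2 * 0) (1 - 2 * η)) := by
  obtain ⟨n, hn, C1, C2, hze, h1, h2⟩ := h.2.2 τ hτ 1
  obtain ⟨η, a1, a2, a3, a4⟩ := finite_bound C1 C2 hze (card_nonempty h2) ∅ (by simpa using Nat.pos_of_ne_zero (by omega)) 1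
    one_pos (fun u => by simpa using (card_nonempty h1).card_pos) 0 le_rfl (by norm_num) (by simp)
  have hn' : (0 : ℝ) < n := by exact_mod_cast hn
  have hl2 := log_two_pos'
  have h3 := log_card_ge h2
  simp only [Finset.card_empty, Nat.cast_zero, sub_zero, Nat.cast_one, Real.log_one, add_zero,
    zero_div] at a3 a4
  have h4 : R2 - τ ≤ Real.log C2.card / (n * Real.log 2) := by
    rw [le_div_iff₀ (by positivity)]
    linarith
  exact ⟨η, a1, a2, h4.trans a3, h4.trans a4⟩

lemma cont_nbhd (R2 δ α τ : ℝ) (hα1 : 0 < 1 - α) (hτ : 0 < τ) : ∃ ω : ℝ, 0 < ω ∧ ∀ x y : ℝ,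
    |x - δ| < ω → |y - α| < ω →
    |(x - y) / (1 - y) - (δ - α) / (1 - α)| < τ ∧
    R2 / (1 - α) + binH ((δ - α) / (1 - α)) - τ / 2 ≤ R2 / (1 - y) + binH ((x - y) / (1 - y)) ∧
    R2 / (1 - α) + binH ((δ - α) / (1 - α)) - α / (1 - α) - τ / 2 ≤
      R2 / (1 - y) + binH ((x - y) / (1 - y)) - y / (1 - y) := by
  have hq : ContinuousAt (fun q : ℝ × ℝ => 1 - q.2) (δ, α) := by fun_prop
  have hq1 : ContinuousAt (fun q : ℝ × ℝ => q.1 - q.2) (δ, α) := by fun_prop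
  have hq2 : ContinuousAt (fun q : ℝ × ℝ => q.2) (δ, α) := by fun_prop
  have hq3 : ContinuousAt (fun _ : ℝ × ℝ => R2) (δ, α) := by fun_prop
  have hne : (fun q : ℝ × ℝ => 1 - q.2) (δ, α) ≠ 0 := hα1.ne'
  have hcont : ContinuousAt (fun q : ℝ × ℝ => (q.1 - q.2) / (1 - q.2)) (δ, α) := hq1.div hq hne
  have hb : ContinuousAt (fun q : ℝ × ℝ => binH ((q.1 - q.2) / (1 - q.2))) (δ, α) :=
    ContinuousAt.comp (g := binH) binH_continuous.continuousAt hcont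
  have hcont3 : ContinuousAt (fun q : ℝ × ℝ => R2 / (1 - q.2) + binH ((q.1 - q.2) / (1 - q.2)))
      (δ, α) := (hq3.div hq hne).add hb
  have hcont2 : ContinuousAt (fun q : ℝ × ℝ => R2 / (1 - q.2) + binH ((q.1 - q.2) / (1 - q.2))
      - q.2 / (1 - q.2)) (δ, α) := hcont3.sub (hq2.div hq hne)
  obtain ⟨ω1, hω1, H1⟩ := Metric.continuousAt_iff.1 hcont τ hτ
  obtain ⟨ω2, hω2, H2⟩ := Metric.continuousAt_iff.1 hcont2 (τ / 2) (by linarith)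
  obtain ⟨ω3, hω3, H3⟩ := Metric.continuousAt_iff.1 hcont3 (τ / 2) (by linarith)
  refine ⟨min ω1 (min ω2 ω3), lt_min hω1 (lt_min hω2 hω3), fun x y hx hy => ?_⟩
  have hdist : dist (x, y) (δ, α) < min ω1 (min ω2 ω3) := by
    rw [Prod.dist_eq, max_lt_iff, Real.dist_eq, Real.dist_eq]
    exact ⟨hx, hy⟩
  have D1 := H1 (hdist.trans_le (min_le_left _ _))
  have D2 := H2 (hdist.trans_le ((min_le_right _ _).trans (min_le_left _ _)))
  have D3 := H3 (hdist.trans_le ((min_le_right _ _).trans (min_le_right _ _)))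
  rw [Real.dist_eq] at D1 D2 D3
  refine ⟨D1, ?_, ?_⟩
  · have := (abs_lt.1 D3).1
    linarith
  · have := (abs_lt.1 D2).1
    linarith

set_option maxHeartbeats 1000000 in
lemma approx_pos {R1 R2 : ℝ} (h : Admissible R1 R2) (δ α : ℝ) (hδ0 : 0 < δ) (hδ1 : δ ≤ 1 / 2)
    (hδ : binH δ = R1) (hα0 : 0 ≤ α) (hα : α ≤ δ) (τ : ℝ) (hτ : 0 < τ) :
    ∃ p' η : ℝ, |p' - (δ - α) / (1 - α)| < τ ∧ p' ≤ η ∧ η ≤ 1 / 2 ∧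
      R2 / (1 - α) + binH ((δ - α) / (1 - α)) - τ ≤ Lfun η ∧
      R2 / (1 - α) + binH ((δ - α) / (1 - α)) - τ ≤
        KF (TF (1 - 2 * p') (1 - 2 * η)) + α / (1 - α) := by
  have hα1 : 0 < 1 - α := by linarith
  have hl2 := log_two_pos'
  obtain ⟨ω, hω0, Hω⟩ := cont_nbhd R2 δ α τ hα1 hτ
  -- choose the shrink factor
  set κ : ℝ := min (1 / 2) (ω / 2) with hκ
  have hκ0 : 0 < κ := lt_min (by norm_num) (by linarith)
  have hκ1 : κ ≤ 1 / 2 := min_le_left _ _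
  have hκω : κ ≤ ω / 2 := min_le_right _ _
  set δ' := δ * (1 - κ) with hδ'
  set α' := α * (1 - κ) with hα'
  have hδ'0 : 0 ≤ δ' := by apply mul_nonneg hδ0.le; linarith
  have hα'0 : 0 ≤ α' := by apply mul_nonneg hα0; linarith
  have hδ'lt : δ' < δ := by nlinarith
  have hα'le : α' ≤ α := by nlinarith
  have hα'δ' : α' ≤ δ' := mul_le_mul_of_nonneg_right hα (by linarith)
  have hHlt : binH δ' < R1 := by
    rw [← hδ]
    exact binH_strictMonoOn ⟨hδ'0, by linarith⟩ ⟨hδ0.le, hδ1⟩ hδ'lt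
  set ε := min ((R1 - binH δ') / 2) (τ / 4) with hε
  have hε0 : 0 < ε := lt_min (by linarith) (by linarith)
  have hε1 : ε ≤ (R1 - binH δ') / 2 := min_le_left _ _
  have hε2 : ε ≤ τ / 4 := min_le_right _ _
  -- eventual facts
  have ev1 : ∀ᶠ n : ℕ in Filter.atTop, 2 * ((n : ℝ) + 1) ≤ Real.exp (ε * Real.log 2 * n) := by
    have hb : 0 < ε * Real.log 2 := by positivity
    have t1 := (tendsto_exp_mul_div_rpow_atTop 1 _ hb).comp tendsto_natCast_atTop_atTop
    filter_upwards [t1.eventually_ge_atTop 4, Filter.eventually_ge_atTop 1] with n hn hn1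
    have hn1' : (1 : ℝ) ≤ n := by exact_mod_cast hn1
    simp only [Function.comp, Real.rpow_one] at hn
    rw [le_div_iff₀ (by linarith)] at hn
    linarith
  have ev2 : ∀ᶠ n : ℕ in Filter.atTop, 1 / (n : ℝ) < ω / 2 :=
    tendsto_one_div_atTop_nhds_zero_nat.eventually_lt_const (by linarith)
  obtain ⟨N, hN⟩ := Filter.eventually_atTop.1 (ev1.and ev2)
  obtain ⟨n, hnN, C1, C2, hze, h1, h2⟩ := h.2.2 ε hε0 (max N 1)
  have hn : 0 < n := lt_of_lt_of_le one_pos ((le_max_right N 1).trans hnN)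
  obtain ⟨e1, e2⟩ := hN n ((le_max_left N 1).trans hnN)
  have hnR : (0 : ℝ) < n := by exact_mod_cast hn
  set d := ⌊δ' * n⌋₊ with hd
  set s := ⌊α' * n⌋₊ with hs
  have hd1 : (d : ℝ) ≤ δ' * n := Nat.floor_le (by positivity)
  have hd2 : δ' * n < d + 1 := Nat.lt_floor_add_one _
  have hs1 : (s : ℝ) ≤ α' * n := Nat.floor_le (by positivity)
  have hs2 : α' * n < s + 1 := Nat.lt_floor_add_one _
  have hsd : s ≤ d := Nat.floor_mono (by gcongr)
  have hdn : 2 * d ≤ n := by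
    have : 2 * (d : ℝ) ≤ n := by nlinarith
    exact_mod_cast this
  set x : ℝ := d / n with hx
  set y : ℝ := s / n with hy
  have hx0 : 0 ≤ x := by positivity
  have hy0 : 0 ≤ y := by positivity
  have hx1 : x ≤ δ' := by rw [hx, div_le_iff₀ hnR]; exact hd1
  have hy1 : y ≤ α' := by rw [hy, div_le_iff₀ hnR]; exact hs1
  have hx2 : δ' < x + 1 / n := by rw [hx, ← add_div, lt_div_iff₀ hnR]; exact hd2
  have hy2 : α' < y + 1 / n := by rw [hy, ← add_div, lt_div_iff₀ hnR]; exact hs2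
  have k1 : δ - δ' ≤ ω / 2 := by rw [hδ']; nlinarith
  have k2 : α - α' ≤ ω / 2 := by rw [hα']; nlinarith
  obtain ⟨D1, D3, D2⟩ := Hω x y (by rw [abs_lt]; constructor <;> linarith)
    (by rw [abs_lt]; constructor <;> linarith)
  have hy3 : 0 < 1 - y := by linarith
  have hns : (n : ℝ) - s = n * (1 - y) := by rw [hy]; field_simp
  have hds : (d : ℝ) - s = n * (x - y) := by rw [hy, hx]; field_simp
  have hp' : ((d : ℝ) - s) / (n - s) = (x - y) / (1 - y) := by
    rw [hns, hds, mul_div_mul_left _ _ hnR.ne']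
  have hr' : (s : ℝ) / (n - s) = y / (1 - y) := by
    have : (s : ℝ) = n * y := by rw [hy]; field_simp
    rw [hns, this, mul_div_mul_left _ _ hnR.ne']
  have hC1 : 2 * ((n : ℝ) + 1) * Real.exp (n * Real.binEntropy ((d : ℝ) / n)) ≤ C1.card := by
    refine le_trans ?_ h1
    rw [Real.rpow_def_of_pos two_pos]
    refine (mul_le_mul_of_nonneg_right e1 (Real.exp_pos _).le).trans ?_
    rw [← Real.exp_add, Real.exp_le_exp]
    have hbx : binH x ≤ binH δ' :=
      binH_strictMonoOn.monotoneOn ⟨hx0, by linarith⟩ ⟨hδ'0, by linarith⟩ hx1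
    have hbe : Real.binEntropy ((d : ℝ) / n) = binH x * Real.log 2 := by
      rw [binH_eq, div_mul_cancel₀ _ hl2.ne']
    rw [hbe]
    have : ε + binH x ≤ R1 - ε := by linarith
    have := mul_le_mul_of_nonneg_left this (mul_nonneg hl2.le hnR.le)
    linarith
  obtain ⟨η, a1, a2, a3, a4⟩ := core C1 C2 hze (card_nonempty h2) d s hsd hdn hn hC1
  rw [hp'] at a1 a3 a4
  rw [hr'] at a4
  have hρ : R2 / (1 - y) - τ / 2 ≤ Real.log C2.card / (((n : ℝ) - s) * Real.log 2) := by
    have h3 := log_card_ge h2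
    rw [hns, le_div_iff₀ (by positivity)]
    refine le_trans ?_ h3
    have : (R2 / (1 - y) - τ / 2) * (n * (1 - y) * Real.log 2) =
      (n * Real.log 2) * (R2 - τ / 2 * (1 - y)) := by field_simp
    rw [this]
    have h5 : R2 - τ / 2 * (1 - y) ≤ R2 - ε := by nlinarith
    have := mul_le_mul_of_nonneg_left h5 (mul_nonneg hnR.le hl2.le)
    linarith
  refine ⟨(x - y) / (1 - y), η, D1, a1, a2, ?_, ?_⟩
  · linarith
  · linarith

theorem adder_outer_bound (R1 R2 : ℝ) (h : Admissible R1 R2) :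
    ∀ α ∈ Set.Icc (0 : ℝ) (binHInv R1),
      R2 ≤ (1 - α) * (RSigma (α / (1 - α)) (binH ((binHInv R1 - α) / (1 - α)))
        - binH ((binHInv R1 - α) / (1 - α))) := by
  rintro α ⟨hα0, hα⟩
  obtain ⟨hδ0, hδ1, hδ⟩ := binHInv_spec h.1 (admissible_le_one h)
  set δ := binHInv R1
  have hα1 : 0 < 1 - α := by linarith
  set p := (δ - α) / (1 - α) with hp
  have hp0 : 0 ≤ p := div_nonneg (by linarith) hα1.le
  have hp1 : p ≤ 1 / 2 := by
    rw [hp, div_le_iff₀ hα1]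
    linarith
  have hr0 : 0 ≤ α / (1 - α) := div_nonneg hα0 hα1.le
  have main : ∃ η : ℝ, p ≤ η ∧ η ≤ 1 / 2 ∧ R2 / (1 - α) + binH p ≤ Lfun η ∧
      R2 / (1 - α) + binH p ≤ Jfun p η + α / (1 - α) := by
    apply limit_step p _ _ hp0 hp1 hr0
    intro τ hτ
    rcases hδ0.eq_or_lt with h0 | h0
    · have hα' : α = 0 := by linarith
      have hp' : p = 0 := by rw [hp, hα', ← h0]; simp
      obtain ⟨η, a1, a2, a3, a4⟩ := approx_zero h τ hτ
      refine ⟨0, η, by simpa [hp'] using hτ, a1, a2, ?_, ?_⟩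
      · rw [hp', hα', binH_zero]; simpa using a3
      · rw [hp', hα', binH_zero]; simpa using a4
    · exact approx_pos h δ α h0 hδ1 hδ hα0 hα τ hτ
  obtain ⟨η, a1, a2, a3, a4⟩ := main
  have hR : R2 / (1 - α) + binH p ≤ RSigma (α / (1 - α)) (binH p) := by
    unfold RSigma
    rw [binHInv_binH hp0 hp1]
    refine (le_min a3 a4).trans (le_csSup ?_ ⟨η, ⟨a1, a2⟩, rfl⟩)
    refine ⟨2, ?_⟩
    rintro _ ⟨z, hz, rfl⟩
    refine (min_le_left _ _).trans ?_
    unfold Lfun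
    have := binH_le_one z
    linarith [hz.1]
  have h3 : R2 / (1 - α) ≤ RSigma (α / (1 - α)) (binH p) - binH p := by linarith
  rw [div_le_iff₀ hα1] at h3
  linarith
end

section
/- (Weldon) Let C1, C2 ⊆ {0,1}^n form a zero-error codebook pair and suppose C1 is systematic, i.e., there exists S ⊆ [n] with |S| = log₂|C1| that is shattered by C1. Then |C2| ≤ 3^{n−|S|}; in particular, if |C1| = 2^{nR1} and |C2| = 2^{nR2}, then R2 ≤ (1−R1)·log₂3. -/
/-- `S ⊆ [n]` is shattered by `C ⊆ {0,1}^n`: every vector in `{0,1}^S` is the restriction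
of some codeword of `C` to `S`. -/
def Shatters {n : ℕ} (C : Finset (Fin n → Fin 2)) (S : Finset (Fin n)) : Prop :=
  ∀ g : ↥S → Fin 2, ∃ c ∈ C, ∀ i : ↥S, c i.1 = g i

/-- Weldon's bound: if `C1` is systematic (shatters a set `S` with `|C1| = 2^{|S|}`) and
`(C1, C2)` is a zero-error codebook pair, then `|C2| ≤ 3^{n - |S|}`; in particular, if
`|C1| = 2^{n R1}` and `|C2| = 2^{n R2}` (with `n > 0`), then `R2 ≤ (1 - R1) log₂ 3`. -/
theorem weldon_bound {n : ℕ} (C1 C2 : Finset (Fin n → Fin 2)) (S : Finset (Fin n))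
    (hze : ZeroErrorPair C1 C2) (hcard : C1.card = 2 ^ S.card) (hsh : Shatters C1 S) :
    C2.card ≤ 3 ^ (n - S.card) ∧
      ∀ R1 R2 : ℝ, 0 < n →
        (C1.card : ℝ) = 2 ^ ((n : ℝ) * R1) → (C2.card : ℝ) = 2 ^ ((n : ℝ) * R2) →
        R2 ≤ (1 - R1) * Real.logb 2 3 := by
  have h1 : C2.card ≤ 3 ^ (n - S.card) := by
    have hex : ∀ b : Fin n → Fin 2, ∃ c ∈ C1, ∀ i ∈ S, (c i : ℕ) + (b i : ℕ) = 1 := by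
      intro b
      obtain ⟨c, hc, h⟩ := hsh (fun i => 1 - b i.1)
      refine ⟨c, hc, fun i hi => ?_⟩
      have h' := h ⟨i, hi⟩
      simp only at h'
      rw [h']
      generalize b i = x
      revert x
      decide
    choose f hf hfS using hex
    let φ : (Fin n → Fin 2) → ({i // i ∈ Sᶜ} → Fin 3) := fun b i =>
      ⟨(f b i.1 : ℕ) + (b i.1 : ℕ), by omega⟩
    have hinj : Set.InjOn φ C2 := by
      intro b hb b' hb' hbb
      have hp : (f b, b) = (f b', b') := by
        apply hze
        · simpa using ⟨hf b, hb⟩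
        · simpa using ⟨hf b', hb'⟩
        · funext i
          by_cases hi : i ∈ S
          · simp only [hfS b i hi, hfS b' i hi]
          · have := congrFun hbb ⟨i, by simpa using hi⟩
            simpa [φ] using this
      exact (Prod.ext_iff.mp hp).2
    have := Finset.card_le_card_of_injOn (t := Finset.univ) φ (fun _ _ => by simp) hinj
    simpa [Finset.card_compl] using this
  refine ⟨h1, fun R1 R2 hn e1 e2 => ?_⟩
  have hS : S.card ≤ n := by simpa using Finset.card_le_univ S
  have hn' : (0 : ℝ) < n := by exact_mod_cast hn
  have a1 : (S.card : ℝ) = n * R1 := by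
    rw [hcard] at e1
    push_cast at e1
    have := congrArg (Real.logb 2) e1
    rw [Real.logb_rpow (by norm_num) (by norm_num), ← Real.rpow_natCast,
      Real.logb_rpow (by norm_num) (by norm_num)] at this
    exact this
  have a2 : (2 : ℝ) ^ ((n : ℝ) * R2) ≤ 3 ^ (n - S.card) := by
    rw [← e2]
    exact_mod_cast h1
  have a3 := Real.logb_le_logb_of_le (b := 2) (by norm_num) (by positivity) a2
  rw [Real.logb_rpow (by norm_num) (by norm_num), Real.logb_pow, Nat.cast_sub hS, a1] at a3
  refine le_of_mul_le_mul_left ?_ hn'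
  linarith
end

section
/- Let C1, C2 ⊆ {0,1}^n form a zero-error codebook pair and let S ⊆ [n]. Call (c1,c2) ∈ C1 × C2 an S-complement pair if c1(S) + c2(S) equals the all-ones vector of length |S|. Then the map sending an S-complement pair (c1,c2) to the restriction of c1+c2 to the complement of S is injective; consequently the number of S-complement pairs is at most 3^{n−|S|}. -/
/-- For a zero-error codebook pair, the map sending an `S`-complement pair `(c1, c2)`
(i.e. `c1(S) + c2(S)` is all ones) to the restriction of `c1 + c2` to the complement of `S`
is injective; consequently the number of `S`-complement pairs is at most `3^{n - |S|}`. -/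
theorem s_complement_pairs {n : ℕ} (C1 C2 : Finset (Fin n → Fin 2)) (S : Finset (Fin n))
    (hze : ZeroErrorPair C1 C2) :
    Set.InjOn
      (fun p : (Fin n → Fin 2) × (Fin n → Fin 2) =>
        fun i : ↥(Sᶜ) => (p.1 i.1 : ℕ) + (p.2 i.1 : ℕ))
      {p : (Fin n → Fin 2) × (Fin n → Fin 2) |
        p.1 ∈ C1 ∧ p.2 ∈ C2 ∧ ∀ i ∈ S, (p.1 i : ℕ) + (p.2 i : ℕ) = 1} ∧
    ((C1 ×ˢ C2).filter
        (fun p : (Fin n → Fin 2) × (Fin n → Fin 2) =>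
          ∀ i ∈ S, (p.1 i : ℕ) + (p.2 i : ℕ) = 1)).card ≤ 3 ^ (n - S.card) := by
  have hinj : Set.InjOn
      (fun p : (Fin n → Fin 2) × (Fin n → Fin 2) =>
        fun i : ↥(Sᶜ) => (p.1 i.1 : ℕ) + (p.2 i.1 : ℕ))
      {p : (Fin n → Fin 2) × (Fin n → Fin 2) |
        p.1 ∈ C1 ∧ p.2 ∈ C2 ∧ ∀ i ∈ S, (p.1 i : ℕ) + (p.2 i : ℕ) = 1} := by
    rintro p ⟨hp1, hp2, hp⟩ q ⟨hq1, hq2, hq⟩ h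
    apply hze
    · simp [hp1, hp2]
    · simp [hq1, hq2]
    · funext i
      by_cases hi : i ∈ S
      · exact (hp i hi).trans (hq i hi).symm
      · exact congrFun h ⟨i, Finset.mem_compl.mpr hi⟩
  refine ⟨hinj, ?_⟩
  have hcard : (Fintype.piFinset (fun _ : ↥(Sᶜ) => Finset.range 3)).card = 3 ^ (n - S.card) := by
    simp [Finset.card_compl]
  rw [← hcard]
  apply Finset.card_le_card_of_injOn
    (fun p : (Fin n → Fin 2) × (Fin n → Fin 2) =>
        fun i : ↥(Sᶜ) => (p.1 i.1 : ℕ) + (p.2 i.1 : ℕ))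
  · intro p _
    simp only [Finset.mem_coe, Fintype.mem_piFinset, Finset.mem_range]
    intro i
    have h1 := (p.1 i.1).isLt
    have h2 := (p.2 i.1).isLt
    omega
  · apply hinj.mono
    intro p hp
    simp only [Finset.coe_filter, Finset.mem_product, Set.mem_setOf_eq] at hp
    exact ⟨hp.1.1, hp.1.2, hp.2⟩
end

section
/- Any admissible rate pair (R1,R2) for the zero-error binary adder channel satisfies R2 ≤ (1 − h⁻¹(R1))·log₂3. -/
open Finset in
/-- Entropy bound on partial binomial sums. -/
lemma sum_choose_le_s5 (n d : ℕ) (q : ℝ) (hq0 : 0 < q) (hq : q ≤ 1 / 2) (hd : (d : ℝ) ≤ q * n)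
    (hdn : d ≤ n) :
    ((∑ k ∈ Finset.Iic d, n.choose k : ℕ) : ℝ) ≤ (2 : ℝ) ^ ((n : ℝ) * binH q) := by
  have h1 : 0 < 1 - q := by linarith
  have key : ∀ k ∈ Finset.Iic d,
      (2 : ℝ) ^ (-((n : ℝ) * binH q)) * (n.choose k : ℝ) ≤
        q ^ k * (1 - q) ^ (n - k) * (n.choose k : ℝ) := by
    intro k hk
    have hk' : k ≤ d := by simpa using hk
    have hkr : (k : ℝ) ≤ q * n := le_trans (by exact_mod_cast hk') hd
    apply mul_le_mul_of_nonneg_right _ (Nat.cast_nonneg _)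
    have e1 : q ^ k * (1 - q) ^ (n - k) =
        (2 : ℝ) ^ ((k : ℝ) * Real.logb 2 q + ((n : ℝ) - k) * Real.logb 2 (1 - q)) := by
      rw [Real.rpow_add (by norm_num), mul_comm (k : ℝ), mul_comm ((n : ℝ) - k),
        Real.rpow_mul (by norm_num), Real.rpow_mul (by norm_num),
        Real.rpow_logb (by norm_num) (by norm_num) hq0,
        Real.rpow_logb (by norm_num) (by norm_num) h1,
        ← Nat.cast_sub (hk'.trans hdn), Real.rpow_natCast, Real.rpow_natCast]
    rw [e1]
    apply Real.rpow_le_rpow_of_exponent_le (by norm_num)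
    have hl : Real.logb 2 q ≤ Real.logb 2 (1 - q) :=
      Real.logb_le_logb_of_le (by norm_num) hq0 (by linarith)
    unfold binH
    nlinarith [mul_nonneg (sub_nonneg.2 hkr) (sub_nonneg.2 hl)]
  have h2 : ∑ k ∈ Finset.Iic d, q ^ k * (1 - q) ^ (n - k) * (n.choose k : ℝ) ≤ 1 := by
    calc _ ≤ ∑ k ∈ Finset.range (n + 1), q ^ k * (1 - q) ^ (n - k) * (n.choose k : ℝ) := by
          apply Finset.sum_le_sum_of_subset_of_nonneg
          · intro k hk
            simp at hk ⊢
            omega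
          · intros
            positivity
      _ = 1 := by rw [← add_pow]; simp
  have h3 := (Finset.sum_le_sum key).trans h2
  rw [← Finset.mul_sum, Real.rpow_neg (by norm_num), inv_mul_le_iff₀ (by positivity), mul_one] at h3
  exact_mod_cast h3

/-- Support of a binary word. -/
def wordSupp {n : ℕ} (a : Fin n → Fin 2) : Finset (Fin n) := Finset.univ.filter (fun i => a i = 1)

lemma wordSupp_inj {n : ℕ} : Function.Injective (wordSupp (n := n)) := by
  intro a b h
  funext i
  have := Finset.ext_iff.1 h i
  simp only [wordSupp, Finset.mem_filter, Finset.mem_univ, true_and] at this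
  generalize a i = x at *
  generalize b i = y at *
  revert this
  revert x y
  decide

/-- A shattered set for the first code bounds the second code. -/
lemma card_le_of_shatters {n : ℕ} (C1 C2 : Finset (Fin n → Fin 2)) (h : ZeroErrorPair C1 C2)
    (s : Finset (Fin n)) (hs : (C1.image wordSupp).Shatters s) :
    C2.card ≤ 3 ^ (n - s.card) := by
  classical
  have hex : ∀ b : Fin n → Fin 2, ∃ a ∈ C1, ∀ i ∈ s, (a i : ℕ) + (b i : ℕ) = 1 := by
    intro b
    obtain ⟨u, hu, hsu⟩ := hs (t := s \ wordSupp b) Finset.sdiff_subset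
    obtain ⟨a, ha, rfl⟩ := Finset.mem_image.1 hu
    refine ⟨a, ha, fun i hi => ?_⟩
    have := Finset.ext_iff.1 hsu i
    simp only [wordSupp, Finset.mem_inter, Finset.mem_sdiff, Finset.mem_filter, Finset.mem_univ,
      true_and, hi] at this
    generalize a i = x at *
    generalize b i = y at *
    revert this
    revert x y
    decide
  choose f hf hfs using hex
  let g : (Fin n → Fin 2) → ({i // i ∉ s} → Fin 3) := fun b i =>
    ⟨(f b i : ℕ) + (b i : ℕ), by omega⟩
  have hg : Set.InjOn g C2 := by
    intro b hb b' hb' hbb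
    have := h (x₁ := (f b, b)) (x₂ := (f b', b')) (by simpa using ⟨hf b, hb⟩)
      (by simpa using ⟨hf b', hb'⟩) (by
        funext i
        by_cases hi : i ∈ s
        · simp only [hfs b i hi, hfs b' i hi]
        · have := congrArg Fin.val (congrFun hbb ⟨i, hi⟩)
          simpa [g] using this)
    exact (Prod.ext_iff.1 this).2
  have := Finset.card_le_card_of_injOn (t := Finset.univ) g (fun _ _ => Finset.mem_univ _) hg
  simpa [Fintype.card_subtype_compl] using this

lemma bddBelow_binHset (y : ℝ) : BddBelow {p : ℝ | 0 ≤ p ∧ p ≤ 1 / 2 ∧ binH p = y} :=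
  ⟨0, fun _ h => h.1⟩

lemma lt_binHInv {q y : ℝ} (hy : 0 ≤ y) (hq0 : 0 < q) (hq : q < binHInv y) :
    q ≤ 1 / 2 ∧ binH q < y := by
  have hne : {p : ℝ | 0 ≤ p ∧ p ≤ 1 / 2 ∧ binH p = y}.Nonempty := by
    by_contra hc
    rw [Set.not_nonempty_iff_eq_empty] at hc
    rw [binHInv, hc, Real.sInf_empty] at hq
    linarith
  obtain ⟨r, hr⟩ := hne
  have hr' : binHInv y ≤ r := csInf_le (bddBelow_binHset y) hr
  have hq2 : q ≤ 1 / 2 := by linarith [hr.2.1]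
  refine ⟨hq2, ?_⟩
  by_contra hc
  push Not at hc
  have h0 : binH 0 = 0 := by simp [binH]
  obtain ⟨t, ht, hty⟩ := intermediate_value_Icc hq0.le binH_continuous.continuousOn
    (show y ∈ Set.Icc (binH 0) (binH q) from ⟨by rw [h0]; exact hy, hc⟩)
  have : binHInv y ≤ t := csInf_le (bddBelow_binHset y) ⟨ht.1, ht.2.trans hq2, hty⟩
  linarith [ht.2]

lemma exists_shatters {n : ℕ} (C1 : Finset (Fin n → Fin 2)) (q : ℝ)
    (hpos : 0 < C1.card)
    (hC : 0 < q → q ≤ 1 / 2 ∧ (2 : ℝ) ^ ((n : ℝ) * binH q) < C1.card) :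
    ∃ s : Finset (Fin n), (C1.image wordSupp).Shatters s ∧ q * n ≤ s.card := by
  classical
  have hne : (C1.image wordSupp).Nonempty := by
    simpa using Finset.card_pos.1 hpos
  have hne2 : (C1.image wordSupp).shatterer.Nonempty :=
    ⟨∅, Finset.mem_shatterer.2 (by
      intro t ht
      obtain ⟨u, hu⟩ := hne
      exact ⟨u, hu, by simp [Finset.subset_empty.1 ht]⟩)⟩
  obtain ⟨s, hs, hsc⟩ := Finset.exists_mem_eq_sup _ hne2 Finset.card
  refine ⟨s, Finset.mem_shatterer.1 hs, ?_⟩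
  by_contra hc
  push Not at hc
  have hq0 : 0 < q := by
    by_contra hq
    have : q * n ≤ 0 := mul_nonpos_of_nonpos_of_nonneg (not_lt.1 hq) (Nat.cast_nonneg _)
    have h2 : (0 : ℝ) ≤ s.card := Nat.cast_nonneg _
    linarith
  obtain ⟨hq, hlt⟩ := hC hq0
  have h1 : C1.card ≤ ∑ k ∈ Finset.Iic s.card, n.choose k := by
    rw [← Finset.card_image_of_injective C1 wordSupp_inj]
    refine (Finset.card_le_card_shatterer _).trans ?_
    have := Finset.card_shatterer_le_sum_vcDim (𝒜 := C1.image wordSupp)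
    rw [Finset.vcDim, hsc, Fintype.card_fin] at this
    exact this
  have hsn : s.card ≤ n := by simpa using Finset.card_le_univ s
  have h2 := sum_choose_le_s5 n s.card q hq0 hq hc.le hsn
  have h3 : (C1.card : ℝ) ≤ ((∑ k ∈ Finset.Iic s.card, n.choose k : ℕ) : ℝ) := by exact_mod_cast h1
  linarith

theorem vc_weldon_bound (R1 R2 : ℝ) (h : Admissible R1 R2) :
    R2 ≤ (1 - binHInv R1) * Real.logb 2 3 := by
  obtain ⟨hR1, hR2, hadm⟩ := h
  have hlog : 0 < Real.logb 2 3 := Real.logb_pos (by norm_num) (by norm_num)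
  have claim : ∀ q < binHInv R1, R2 ≤ (1 - q) * Real.logb 2 3 := by
    intro q hq
    apply le_of_forall_pos_le_add
    intro δ hδ
    obtain ⟨ε, hε, hεδ, hεq⟩ : ∃ ε : ℝ, 0 < ε ∧ ε ≤ δ ∧ (0 < q → ε < R1 - binH q) := by
      by_cases hq0 : 0 < q
      · have := (lt_binHInv hR1 hq0 hq).2
        refine ⟨min δ ((R1 - binH q) / 2), lt_min hδ (by linarith), min_le_left _ _, fun _ => ?_⟩
        exact lt_of_le_of_lt (min_le_right _ _) (by linarith)
      · exact ⟨δ, hδ, le_rfl, fun h => absurd h hq0⟩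
    obtain ⟨n, hn, C1, C2, hz, h1, h2⟩ := hadm ε hε 1
    have hn0 : (0 : ℝ) < n := by exact_mod_cast hn
    have hpos : 0 < C1.card := by
      have : (0 : ℝ) < C1.card := lt_of_lt_of_le (by positivity) h1
      exact_mod_cast this
    obtain ⟨s, hs, hsq⟩ := exists_shatters C1 q hpos (fun hq0 =>
      ⟨(lt_binHInv hR1 hq0 hq).1, lt_of_lt_of_le
        (Real.rpow_lt_rpow_of_exponent_lt (by norm_num)
          (mul_lt_mul_of_pos_left (by linarith [hεq hq0]) hn0)) h1⟩)
    have hsn : s.card ≤ n := by simpa using Finset.card_le_univ s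
    have h3 : (C2.card : ℝ) ≤ (3 : ℝ) ^ (n - s.card) := by
      exact_mod_cast card_le_of_shatters C1 C2 hz s hs
    have h4 := Real.logb_le_logb_of_le (b := 2) (by norm_num) (by positivity) (h2.trans h3)
    rw [Real.logb_rpow (by norm_num) (by norm_num), Real.logb_pow, Nat.cast_sub hsn] at h4
    have h5 : (n : ℝ) * (R2 - ε) ≤ n * ((1 - q) * Real.logb 2 3) := by
      refine h4.trans ?_
      rw [← mul_assoc]
      exact mul_le_mul_of_nonneg_right (by linarith) hlog.le
    have h6 := le_of_mul_le_mul_left h5 hn0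
    linarith
  by_contra hc
  push Not at hc
  have h7 := claim (binHInv R1 - (R2 - (1 - binHInv R1) * Real.logb 2 3) / (2 * Real.logb 2 3))
    (by
      have : 0 < (R2 - (1 - binHInv R1) * Real.logb 2 3) / (2 * Real.logb 2 3) :=
        div_pos (by linarith) (by linarith)
      linarith)
  have h8 : (R2 - (1 - binHInv R1) * Real.logb 2 3) / (2 * Real.logb 2 3) * Real.logb 2 3 =
      (R2 - (1 - binHInv R1) * Real.logb 2 3) / 2 := by
    field_simp
  nlinarith
end
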